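/- Two fibrations of the 2-torus T² over S¹ representing the same class in H¹(T²; ℤ) are isotopic; equivalently, a fiber bundle map T² → S¹ is determined up to fiber-preserving isotopy by its induced map on first cohomology. -/

import Mathlib

/-- `p : E → B` is a fiber bundle projection with fiber `F`: every point of the base has
an open neighborhood `U` over which `p` is trivial, via a homeomorphism
`p⁻¹(U) ≃ₜ U × F` commuting with the projections to `U`. -/
def IsFiberBundleProj {E B : Type*} [TopologicalSpace E] [TopologicalSpace B]
    (F : Type*) [TopologicalSpace F] (p : E → B) : Prop :=
  ∀ b : B, ∃ U : Set B, IsOpen U ∧ b ∈ U ∧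
    ∃ e : (p ⁻¹' U) ≃ₜ U × F, ∀ z : p ⁻¹' U, ((e z).1 : B) = p z

namespace TorusIsotopy

open Filter Topology Metric Set

/-- Montel's theorem along an ultrafilter. -/
theorem exists_tendstoLocallyUniformlyOn_of_norm_le {ι : Type*} (l : Ultrafilter ι) {U : Set ℂ}
    (hU : IsOpen U) {F : ι → ℂ → ℂ} {M : ℝ}
    (hd : ∀ᶠ i in (l : Filter ι), DifferentiableOn ℂ (F i) U)
    (hM : ∀ᶠ i in (l : Filter ι), ∀ z ∈ U, ‖F i z‖ ≤ M) :
    ∃ f : ℂ → ℂ, TendstoLocallyUniformlyOn F f l U := by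
  have key : ∀ z, ∃ w, z ∈ U → Tendsto (fun i => F i z) l (𝓝 w) := by
    intro z
    by_cases hz : z ∈ U
    · obtain ⟨w, -, hw⟩ := (isCompact_closedBall (0 : ℂ) M).ultrafilter_le_nhds
        (l.map (fun i => F i z)) (by
          rw [le_principal_iff, Ultrafilter.mem_coe, Ultrafilter.mem_map, ← Ultrafilter.mem_coe]
          filter_upwards [hM] with i hi
          simpa using hi z hz)
      exact ⟨w, fun _ => hw⟩
    · exact ⟨0, fun h => absurd h hz⟩
  choose f hf using key
  refine ⟨f, Metric.tendstoLocallyUniformlyOn_iff.2 fun ε hε z₀ hz₀ => ?_⟩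
  obtain ⟨r, hr, hrU⟩ := Metric.isOpen_iff.1 hU z₀ hz₀
  set C : ℝ := 2 * |M| / r with hC
  have hC0 : 0 ≤ C := by positivity
  have hlip : ∀ᶠ i in (l : Filter ι), ∀ z ∈ ball z₀ r, dist (F i z) (F i z₀) ≤ C * dist z z₀ := by
    filter_upwards [hd, hM] with i hi hi' z hz
    refine Complex.dist_le_div_mul_dist_of_mapsTo_ball (hi.mono hrU) (fun w hw => ?_) hz
    rw [mem_closedBall]
    calc dist (F i w) (F i z₀) ≤ ‖F i w‖ + ‖F i z₀‖ := dist_le_norm_add_norm _ _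
      _ ≤ |M| + |M| := add_le_add ((hi' _ (hrU hw)).trans (le_abs_self _))
          ((hi' _ hz₀).trans (le_abs_self _))
      _ = 2 * |M| := by ring
  have hlip' : ∀ z ∈ ball z₀ r, dist (f z) (f z₀) ≤ C * dist z z₀ := by
    intro z hz
    refine le_of_tendsto ((hf z (hrU hz)).dist (hf z₀ hz₀)) ?_
    filter_upwards [hlip] with i hi using hi z hz
  obtain ⟨δ, hδ, hδr, hδC⟩ : ∃ δ > 0, δ ≤ r ∧ C * δ < ε / 3 := by
    refine ⟨min r (ε / 6 / (C + 1)), by positivity, min_le_left _ _, ?_⟩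
    calc C * min r (ε / 6 / (C + 1)) ≤ (C + 1) * (ε / 6 / (C + 1)) := by
          gcongr
          · linarith
          · exact min_le_right _ _
      _ = ε / 6 := by field_simp
      _ < ε / 3 := by linarith
  refine ⟨ball z₀ δ, mem_nhdsWithin_of_mem_nhds (ball_mem_nhds _ hδ), ?_⟩
  filter_upwards [hlip, (hf z₀ hz₀).eventually (ball_mem_nhds _ (by positivity : 0 < ε / 3))]
    with i hi hi' y hy
  have h1 := hlip' y (ball_subset_ball hδr hy)
  have h2 := hi y (ball_subset_ball hδr hy)
  have h3 : C * dist y z₀ ≤ C * δ := mul_le_mul_of_nonneg_left (mem_ball.1 hy).le hC0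
  have h4 : dist (f y) (F i y) ≤ dist (f y) (f z₀) + dist (f z₀) (F i z₀) + dist (F i z₀) (F i y) :=
    dist_triangle4 _ _ _ _
  rw [dist_comm] at hi'
  rw [dist_comm (F i y)] at h2
  linarith

/-- Hurwitz's theorem: near an isolated zero of the limit, the approximants have zeros. -/
theorem eventually_exists_zero_of_tendsto {ι : Type*} {l : Filter ι} [l.NeBot]
    {U : Set ℂ} (hU : IsOpen U) {F : ι → ℂ → ℂ} {f : ℂ → ℂ}
    (hF : TendstoLocallyUniformlyOn F f l U) (hd : ∀ᶠ i in l, DifferentiableOn ℂ (F i) U)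
    {z₀ : ℂ} (hz₀ : z₀ ∈ U) (h0 : f z₀ = 0) (hne : ¬ ∀ᶠ z in 𝓝 z₀, f z = 0)
    {V : Set ℂ} (hV : V ∈ 𝓝 z₀) : ∀ᶠ i in l, ∃ z ∈ V, z ∈ U ∧ F i z = 0 := by
  have hfd : DifferentiableOn ℂ f U := hF.differentiableOn hd hU
  have hfa : AnalyticAt ℂ f z₀ := hfd.analyticAt (hU.mem_nhds hz₀)
  have h1 := hfa.eventually_eq_zero_or_eventually_ne_zero.resolve_left hne
  rw [eventually_nhdsWithin_iff] at h1
  obtain ⟨r, hr, hrs⟩ := Metric.nhds_basis_closedBall.mem_iff.1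
    (inter_mem (inter_mem hV (hU.mem_nhds hz₀)) h1)
  have hrU : closedBall z₀ r ⊆ U := fun z hz => (hrs hz).1.2
  have hsph : ∀ z ∈ sphere z₀ r, f z ≠ 0 := fun z hz =>
    (hrs (sphere_subset_closedBall hz)).2 (ne_of_mem_sphere hz hr.ne')
  obtain ⟨x, hx, hxm⟩ := (isCompact_sphere z₀ r).exists_isMinOn
    (NormedSpace.sphere_nonempty.2 hr.le)
    ((hfd.continuousOn.mono (sphere_subset_closedBall.trans hrU)).norm)
  set m := ‖f x‖ with hm
  have hm0 : 0 < m := norm_pos_iff.2 (hsph x hx)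
  have hunif := (tendstoLocallyUniformlyOn_iff_forall_isCompact hU).1 hF _ hrU
    (isCompact_closedBall z₀ r)
  filter_upwards [hd, Metric.tendstoUniformlyOn_iff.1 hunif (m / 2) (by positivity)] with i hi hi'
  by_contra! hcon
  have hnz : ∀ z ∈ closedBall z₀ r, F i z ≠ 0 := fun z hz => hcon z (hrs hz).1.1 (hrU hz)
  have hcl : closure (ball z₀ r) = closedBall z₀ r := closure_ball _ hr.ne'
  have hdc : DiffContOnCl ℂ (fun z => (F i z)⁻¹) (ball z₀ r) := by
    refine DifferentiableOn.diffContOnCl ?_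
    rw [hcl]
    exact (hi.mono hrU).inv hnz
  have hb := Complex.norm_le_of_forall_mem_frontier_norm_le (C := (m / 2)⁻¹) isBounded_ball hdc
    (fun z hz => by
      rw [frontier_ball _ hr.ne'] at hz
      rw [norm_inv]
      have := hi' z (sphere_subset_closedBall hz)
      have h2 : m ≤ ‖f z‖ := hxm hz
      have h3 := norm_sub_norm_le (f z) (F i z)
      rw [dist_eq_norm] at this
      gcongr
      linarith) (subset_closure (mem_ball_self hr))
  have h4 := hi' z₀ (mem_closedBall_self hr.le)
  rw [h0, dist_zero_left] at h4
  rw [norm_inv] at hb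
  have h5 : 0 < ‖F i z₀‖ := norm_pos_iff.2 (hnz _ (mem_closedBall_self hr.le))
  exact absurd ((inv_le_inv₀ h5 (by positivity)).1 hb) (not_le.2 h4)

theorem injOn_of_tendstoLocallyUniformlyOn {ι : Type*} {l : Filter ι} [l.NeBot]
    {U : Set ℂ} (hU : IsOpen U) (hUc : IsPreconnected U) {F : ι → ℂ → ℂ} {f : ℂ → ℂ}
    (hF : TendstoLocallyUniformlyOn F f l U) (hd : ∀ᶠ i in l, DifferentiableOn ℂ (F i) U)
    (hinj : ∀ᶠ i in l, InjOn (F i) U) {w : ℂ} (hw : w ∈ U) (hfw : deriv f w ≠ 0) :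
    InjOn f U := by
  intro a ha b hb hab
  by_contra hne
  have hfd : DifferentiableOn ℂ f U := hF.differentiableOn hd hU
  have hG : TendstoLocallyUniformlyOn (fun i z => F i z - F i a) (fun z => f z - f a) l U := by
    have h1 : TendstoUniformlyOn (fun i (_ : ℂ) => F i a) (fun _ => f a) l U :=
      (hF.tendsto_at ha).tendstoUniformlyOn_const U
    exact hF.fun_sub h1.tendstoLocallyUniformlyOn
  have hnc : ¬ ∀ᶠ z in 𝓝 b, f z - f a = 0 := by
    intro h
    have h2 := AnalyticOnNhd.eqOn_zero_of_preconnected_of_eventuallyEq_zero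
      ((hfd.sub_const (f a)).analyticOnNhd hU) hUc hb h
    apply hfw
    have h3 : f =ᶠ[𝓝 w] fun _ => f a := by
      filter_upwards [hU.mem_nhds hw] with z hz using sub_eq_zero.1 (h2 hz)
    rw [h3.deriv_eq, deriv_const]
  have hev := eventually_exists_zero_of_tendsto hU hG (hd.mono fun i hi => hi.sub_const _) hb
    (by simp [hab]) hnc (isOpen_ne.mem_nhds (Ne.symm hne) : {z | z ≠ a} ∈ 𝓝 b)
  obtain ⟨i, ⟨z, hza, hzU, hz⟩, hi⟩ := (hev.and hinj).exists
  exact hza (hi hzU ha (sub_eq_zero.1 hz))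

theorem deriv_ne_zero_of_tendstoLocallyUniformlyOn {ι : Type*} {l : Filter ι} [l.NeBot]
    {U : Set ℂ} (hU : IsOpen U) (hUc : IsPreconnected U) {F : ι → ℂ → ℂ} {f : ℂ → ℂ}
    (hF : TendstoLocallyUniformlyOn F f l U) (hd : ∀ᶠ i in l, DifferentiableOn ℂ (F i) U)
    (hne : ∀ᶠ i in l, ∀ z ∈ U, deriv (F i) z ≠ 0) {w : ℂ} (hw : w ∈ U) (hfw : deriv f w ≠ 0)
    {z : ℂ} (hz : z ∈ U) : deriv f z ≠ 0 := by
  intro h0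
  have hfd : DifferentiableOn ℂ f U := hF.differentiableOn hd hU
  have hnc : ¬ ∀ᶠ z in 𝓝 z, deriv f z = 0 := fun h =>
    hfw (AnalyticOnNhd.eqOn_zero_of_preconnected_of_eventuallyEq_zero
      ((hfd.deriv hU).analyticOnNhd hU) hUc hz h hw)
  obtain ⟨i, ⟨y, -, hyU, hy⟩, hi⟩ := ((eventually_exists_zero_of_tendsto hU (hF.deriv hd hU)
    (hd.mono fun i hi => hi.deriv hU) hz h0 hnc univ_mem).and hne).exists
  exact hi y hyU hy

/-- The disc automorphism sending `a` to `0`. -/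
noncomputable def mobius (a w : ℂ) : ℂ := (w - a) / (1 - starRingEnd ℂ a * w)

theorem mobius_denom_ne_zero {a w : ℂ} (ha : ‖a‖ < 1) (hw : ‖w‖ < 1) :
    1 - starRingEnd ℂ a * w ≠ 0 := by
  intro h
  have h1 : ‖starRingEnd ℂ a * w‖ < 1 := by
    rw [norm_mul, RCLike.norm_conj]
    nlinarith [norm_nonneg a, norm_nonneg w]
  rw [← sub_eq_zero.1 h] at h1
  simp at h1

theorem norm_mobius_lt_one {a w : ℂ} (ha : ‖a‖ < 1) (hw : ‖w‖ < 1) : ‖mobius a w‖ < 1 := by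
  have h0 := norm_pos_iff.2 (mobius_denom_ne_zero ha hw)
  rw [mobius, norm_div, div_lt_one h0, ← sq_lt_sq₀ (norm_nonneg _) (norm_nonneg _),
    ← Complex.normSq_eq_norm_sq, ← Complex.normSq_eq_norm_sq]
  have h1 : Complex.normSq a < 1 := by
    rw [Complex.normSq_eq_norm_sq]; nlinarith [norm_nonneg a]
  have h2 : Complex.normSq w < 1 := by
    rw [Complex.normSq_eq_norm_sq]; nlinarith [norm_nonneg w]
  have h3 : Complex.normSq (1 - starRingEnd ℂ a * w) - Complex.normSq (w - a)
      = (1 - Complex.normSq a) * (1 - Complex.normSq w) := by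
    simp only [Complex.normSq_apply, Complex.sub_re, Complex.sub_im, Complex.one_re,
      Complex.one_im, Complex.mul_re, Complex.mul_im, Complex.conj_re, Complex.conj_im]
    ring
  nlinarith [mul_pos (sub_pos.2 h1) (sub_pos.2 h2)]

theorem one_sub_conj_mul_self (a : ℂ) : 1 - starRingEnd ℂ a * a = ((1 - ‖a‖ ^ 2 : ℝ) : ℂ) := by
  rw [← Complex.normSq_eq_conj_mul_self, Complex.normSq_eq_norm_sq]
  push_cast; ring

theorem hasDerivAt_mobius {a w : ℂ} (ha : ‖a‖ < 1) (hw : ‖w‖ < 1) :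
    HasDerivAt (mobius a)
      (((1 - ‖a‖ ^ 2 : ℝ) : ℂ) / (1 - starRingEnd ℂ a * w) ^ 2) w := by
  have h1 : HasDerivAt (fun w : ℂ => w - a) 1 w := (hasDerivAt_id w).sub_const a
  have h2 : HasDerivAt (fun w : ℂ => 1 - starRingEnd ℂ a * w) (-(starRingEnd ℂ a * 1)) w :=
    ((hasDerivAt_id w).const_mul _).const_sub 1
  refine (h1.div h2 (mobius_denom_ne_zero ha hw)).congr_deriv ?_
  rw [← one_sub_conj_mul_self]
  congr 1; ring

theorem mobius_injOn {a : ℂ} (ha : ‖a‖ < 1) : InjOn (mobius a) (ball 0 1) := by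
  intro x hx y hy hxy
  rw [mem_ball_zero_iff] at hx hy
  rw [mobius, mobius, div_eq_div_iff (mobius_denom_ne_zero ha hx) (mobius_denom_ne_zero ha hy)]
    at hxy
  have h1 : (x - y) * (1 - starRingEnd ℂ a * a) = 0 := by linear_combination hxy
  rw [one_sub_conj_mul_self] at h1
  rcases mul_eq_zero.1 h1 with h | h
  · exact sub_eq_zero.1 h
  · have : (1 - ‖a‖ ^ 2 : ℝ) = 0 := by exact_mod_cast h
    nlinarith [norm_nonneg a]

theorem hasDerivAt_of_sq_eq {g u : ℂ → ℂ} {u' z₀ : ℂ} (hg : ContinuousAt g z₀)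
    (hgu : ∀ z, g z ^ 2 = u z) (hu : HasDerivAt u u' z₀) (h0 : g z₀ ≠ 0) :
    HasDerivAt g (u' / (2 * g z₀)) z₀ := by
  rw [hasDerivAt_iff_tendsto_slope] at hu ⊢
  have h1 : Tendsto (fun z => g z + g z₀) (𝓝[≠] z₀) (𝓝 (2 * g z₀)) := by
    rw [two_mul]
    exact (hg.tendsto.mono_left nhdsWithin_le_nhds).add_const _
  have h2 : (2 : ℂ) * g z₀ ≠ 0 := mul_ne_zero two_ne_zero h0
  refine (hu.div h1 h2).congr' ?_
  filter_upwards [h1.eventually_ne h2] with z hz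
  rw [Pi.div_apply, div_eq_iff hz, slope_def_field, slope_def_field, ← hgu, ← hgu]
  ring

/-- Injective holomorphic maps to the unit disc fixing the origin. -/
structure IsDiscEmbedding (D : Set ℂ) (f : ℂ → ℂ) : Prop where
  diff : DifferentiableOn ℂ f D
  maps : MapsTo f D (ball 0 1)
  inj : InjOn f D
  deriv_ne : ∀ z ∈ D, deriv f z ≠ 0
  zero : f 0 = 0

theorem IsDiscEmbedding.mobius_comp {D : Set ℂ} (hD : IsOpen D) {f : ℂ → ℂ} {a : ℂ}
    (ha : ‖a‖ < 1) (hf : DifferentiableOn ℂ f D) (hm : MapsTo f D (ball 0 1)) (hi : InjOn f D)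
    (hne : ∀ z ∈ D, deriv f z ≠ 0) :
    DifferentiableOn ℂ (mobius a ∘ f) D ∧ MapsTo (mobius a ∘ f) D (ball 0 1) ∧
      InjOn (mobius a ∘ f) D ∧ ∀ z ∈ D, deriv (mobius a ∘ f) z ≠ 0 ∧ deriv (mobius a ∘ f) z =
        ((1 - ‖a‖ ^ 2 : ℝ) : ℂ) / (1 - starRingEnd ℂ a * f z) ^ 2 * deriv f z := by
  have hder : ∀ z ∈ D, HasDerivAt (mobius a ∘ f)
      (((1 - ‖a‖ ^ 2 : ℝ) : ℂ) / (1 - starRingEnd ℂ a * f z) ^ 2 * deriv f z) z := fun z hz =>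
    (hasDerivAt_mobius ha (mem_ball_zero_iff.1 (hm hz))).comp z
      (hf.differentiableAt (hD.mem_nhds hz)).hasDerivAt
  refine ⟨fun z hz => (hder z hz).differentiableAt.differentiableWithinAt, fun z hz => ?_,
    (mobius_injOn ha).comp hi hm, fun z hz => ⟨?_, (hder z hz).deriv⟩⟩
  · exact mem_ball_zero_iff.2 (norm_mobius_lt_one ha (mem_ball_zero_iff.1 (hm hz)))
  · rw [(hder z hz).deriv]
    refine mul_ne_zero (div_ne_zero ?_ (pow_ne_zero _
      (mobius_denom_ne_zero ha (mem_ball_zero_iff.1 (hm hz))))) (hne z hz)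
    rw [Complex.ofReal_ne_zero]
    nlinarith [norm_nonneg a]

/-- Koebe's square root trick. -/
theorem IsDiscEmbedding.exists_norm_deriv_lt {D : Set ℂ} (hD : IsOpen D) (hsc : IsSimplyConnected D)
    (h0 : (0 : ℂ) ∈ D) {f : ℂ → ℂ} (hf : IsDiscEmbedding D f) {a : ℂ} (ha : ‖a‖ < 1)
    (haf : a ∉ f '' D) : ∃ F, IsDiscEmbedding D F ∧ ‖deriv f 0‖ < ‖deriv F 0‖ := by
  obtain ⟨hu1, hu2, hu3, hu4⟩ := IsDiscEmbedding.mobius_comp hD ha hf.diff hf.maps hf.inj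
    hf.deriv_ne
  set u := mobius a ∘ f with hu
  have hune : ∀ z ∈ D, u z ≠ 0 := by
    intro z hz h
    simp only [hu, Function.comp, mobius, div_eq_zero_iff] at h
    rcases h with h | h
    · exact haf ⟨z, hz, sub_eq_zero.1 h⟩
    · exact mobius_denom_ne_zero ha (mem_ball_zero_iff.1 (hf.maps hz)) h
  obtain ⟨g, hgc, hgu⟩ := Complex.exists_continuousOn_pow_eq hsc hD hu1.continuousOn
    (by rintro ⟨z, hz, h⟩; exact hune z hz h) two_ne_zero
  have hgne : ∀ z ∈ D, g z ≠ 0 := fun z hz h => hune z hz (by rw [← hgu, h]; simp)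
  have hgd : ∀ z ∈ D, HasDerivAt g (deriv u z / (2 * g z)) z := fun z hz =>
    hasDerivAt_of_sq_eq (hgc.continuousAt (hD.mem_nhds hz)) hgu
      (hu1.differentiableAt (hD.mem_nhds hz)).hasDerivAt (hgne z hz)
  have hgm : MapsTo g D (ball 0 1) := by
    intro z hz
    have h1 := mem_ball_zero_iff.1 (hu2 hz)
    rw [← hgu, norm_pow] at h1
    rw [mem_ball_zero_iff]
    exact lt_of_pow_lt_pow_left₀ 2 zero_le_one (by simpa using h1)
  have hgi : InjOn g D := fun x hx y hy hxy => hu3 hx hy (by rw [← hgu, ← hgu, hxy])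
  have hg0 : ‖g 0‖ < 1 := mem_ball_zero_iff.1 (hgm h0)
  obtain ⟨hF1, hF2, hF3, hF4⟩ := IsDiscEmbedding.mobius_comp hD hg0
    (fun z hz => (hgd z hz).differentiableAt.differentiableWithinAt) hgm hgi (fun z hz => by
      rw [(hgd z hz).deriv]
      exact div_ne_zero (hu4 z hz).1 (mul_ne_zero two_ne_zero (hgne z hz)))
  refine ⟨mobius (g 0) ∘ g, ⟨hF1, hF2, hF3, fun z hz => (hF4 z hz).1, by simp [mobius]⟩, ?_⟩
  rw [(hF4 0 h0).2, (hgd 0 h0).deriv, (hu4 0 h0).2, hf.zero, one_sub_conj_mul_self]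
  have hu0 : ‖g 0‖ ^ 2 = ‖a‖ := by
    rw [← norm_pow, hgu, hu]
    simp [mobius, hf.zero]
  have hr0 : 0 < ‖g 0‖ := norm_pos_iff.2 (hgne 0 h0)
  have hd0 : 0 < ‖deriv f 0‖ := norm_pos_iff.2 (hf.deriv_ne 0 h0)
  set r := ‖g 0‖
  have h1 : 0 < 1 - r ^ 2 := by nlinarith
  have h2 : 0 < 1 - ‖a‖ ^ 2 := by nlinarith [norm_nonneg a]
  simp only [norm_mul, norm_div, norm_pow, Complex.norm_real, Real.norm_of_nonneg h1.le,
    Real.norm_of_nonneg h2.le, mul_zero, sub_zero, one_pow, div_one, Complex.norm_two]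
  rw [← hu0] at h2 ⊢
  change _ < (1 - r ^ 2) / (1 - r ^ 2) ^ 2 * ((1 - (r ^ 2) ^ 2) * ‖deriv f 0‖ / (2 * r))
  have h3 : (1 - r ^ 2) / (1 - r ^ 2) ^ 2 * ((1 - (r ^ 2) ^ 2) * ‖deriv f 0‖ / (2 * r))
      = ‖deriv f 0‖ * ((1 + r ^ 2) / (2 * r)) := by
    field_simp
    ring
  rw [h3]
  refine lt_mul_of_one_lt_right hd0 ?_
  rw [one_lt_div (by positivity)]
  nlinarith [sq_pos_of_pos (sub_pos.2 hg0)]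

theorem exists_maximal_discEmbedding {D : Set ℂ} (hD : IsOpen D) (hb : Bornology.IsBounded D)
    (hc : IsPreconnected D) (h0 : (0 : ℂ) ∈ D) :
    ∃ f, IsDiscEmbedding D f ∧ ∀ g, IsDiscEmbedding D g → ‖deriv g 0‖ ≤ ‖deriv f 0‖ := by
  set S : Set ℝ := {x | ∃ f, IsDiscEmbedding D f ∧ x = ‖deriv f 0‖} with hS
  obtain ⟨M, hM0, hM⟩ := hb.exists_pos_norm_lt
  have hMc : (M : ℂ) ≠ 0 := Complex.ofReal_ne_zero.2 hM0.ne'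
  have hder : ∀ z : ℂ, HasDerivAt (fun z : ℂ => z / M) (1 / M) z := fun z =>
    (hasDerivAt_id z).div_const _
  have hne : (1 / M : ℝ) ∈ S := by
    refine ⟨fun z => z / M, ⟨fun z _ => (hder z).differentiableAt.differentiableWithinAt,
      fun z hz => ?_, fun x _ y _ hxy => ?_, fun z _ => ?_, by simp⟩, ?_⟩
    · rw [mem_ball_zero_iff, norm_div, Complex.norm_real, Real.norm_of_nonneg hM0.le,
        div_lt_one hM0]
      exact hM z hz
    · exact (div_left_inj' hMc).1 hxy
    · rw [(hder z).deriv]; exact one_div_ne_zero hMc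
    · rw [(hder 0).deriv, norm_div, Complex.norm_real, Real.norm_of_nonneg hM0.le, norm_one]
  obtain ⟨r, hr, hrD⟩ := Metric.isOpen_iff.1 hD 0 h0
  have hbdd : BddAbove S := by
    refine ⟨1 / r, ?_⟩
    rintro _ ⟨f, hf, rfl⟩
    refine Complex.norm_deriv_le_div_of_mapsTo_ball (hf.diff.mono hrD) (fun z hz => ?_) hr
    rw [hf.zero]
    exact ball_subset_closedBall (hf.maps (hrD hz))
  obtain ⟨x, -, hx, hxS⟩ := exists_seq_tendsto_sSup ⟨_, hne⟩ hbdd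
  choose F hF hFx using hxS
  set l := Filter.hyperfilter ℕ
  have hl : (l : Filter ℕ) ≤ atTop := Nat.cofinite_eq_atTop ▸ Filter.hyperfilter_le_cofinite
  obtain ⟨f, hf⟩ := exists_tendstoLocallyUniformlyOn_of_norm_le l hD (F := F) (M := 1)
    (Eventually.of_forall fun n => (hF n).diff)
    (Eventually.of_forall fun n z hz => (mem_ball_zero_iff.1 ((hF n).maps hz)).le)
  have hd : ∀ᶠ n in (l : Filter ℕ), DifferentiableOn ℂ (F n) D :=
    Eventually.of_forall fun n => (hF n).diff
  have hfd := hf.differentiableOn hd hD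
  have hnd : ‖deriv f 0‖ = sSup S := by
    refine tendsto_nhds_unique ((hf.deriv hd hD).tendsto_at h0).norm ?_
    refine (hx.mono_left hl).congr fun n => ?_
    rw [hFx]; rfl
  have hpos : 0 < ‖deriv f 0‖ := by
    rw [hnd]
    exact (by positivity : 0 < 1 / M).trans_le (le_csSup hbdd hne)
  have hmc : ∀ z ∈ D, ‖f z‖ ≤ 1 := fun z hz => le_of_tendsto (hf.tendsto_at hz).norm
    (Eventually.of_forall fun n => (mem_ball_zero_iff.1 ((hF n).maps hz)).le)
  refine ⟨f, ⟨hfd, fun z hz => ?_, ?_, fun z hz => ?_, ?_⟩, fun g hg => ?_⟩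
  · rw [mem_ball_zero_iff]
    refine lt_of_le_of_ne (hmc z hz) fun h1 => ?_
    have h2 := Complex.eqOn_of_isPreconnected_of_isMaxOn_norm hc hD hfd hz
      (fun w hw => by simpa [h1] using hmc w hw)
    have h3 : f =ᶠ[𝓝 0] fun _ => f z := by
      filter_upwards [hD.mem_nhds h0] with w hw using h2 hw
    rw [h3.deriv_eq, deriv_const, norm_zero] at hpos
    exact hpos.false
  · exact injOn_of_tendstoLocallyUniformlyOn hD hc hf hd (Eventually.of_forall fun n => (hF n).inj)
      h0 (norm_pos_iff.1 hpos)
  · exact deriv_ne_zero_of_tendstoLocallyUniformlyOn hD hc hf hd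
      (Eventually.of_forall fun n => (hF n).deriv_ne) h0 (norm_pos_iff.1 hpos) hz
  · exact tendsto_nhds_unique (hf.tendsto_at h0) (by simp [(hF _).zero])
  · rw [hnd]
    exact le_csSup hbdd ⟨g, hg, rfl⟩

/-- `φ` maps the unit disc biholomorphically onto `D`, with inverse `f`, fixes `0` and has
derivative `h` there. -/
structure IsRiemannMap (D : Set ℂ) (φ f : ℂ → ℂ) (h : ℝ) : Prop where
  diff : DifferentiableOn ℂ φ (ball 0 1)
  diff_inv : DifferentiableOn ℂ f D
  maps : MapsTo φ (ball 0 1) D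
  maps_inv : MapsTo f D (ball 0 1)
  left_inv : ∀ u ∈ ball (0 : ℂ) 1, f (φ u) = u
  right_inv : ∀ z ∈ D, φ (f z) = z
  zero : φ 0 = 0
  deriv_zero : deriv φ 0 = h
  pos : 0 < h

/-- The Riemann mapping theorem for bounded domains. -/
theorem exists_isRiemannMap {D : Set ℂ} (hD : IsOpen D) (hb : Bornology.IsBounded D)
    (hsc : IsSimplyConnected D) (h0 : (0 : ℂ) ∈ D) : ∃ φ f h, IsRiemannMap D φ f h := by
  obtain ⟨f₀, hf₀, hmax⟩ := exists_maximal_discEmbedding hD hb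
    hsc.isPathConnected.isConnected.isPreconnected h0
  have hr : 0 < ‖deriv f₀ 0‖ := norm_pos_iff.2 (hf₀.deriv_ne 0 h0)
  set c : ℂ := starRingEnd ℂ (deriv f₀ 0) / ‖deriv f₀ 0‖ with hc
  have hrc : ((‖deriv f₀ 0‖ : ℝ) : ℂ) ≠ 0 := Complex.ofReal_ne_zero.2 hr.ne'
  have hcn : ‖c‖ = 1 := by
    rw [hc, norm_div, RCLike.norm_conj, Complex.norm_real, norm_norm, div_self hr.ne']
  have hc0 : c ≠ 0 := norm_pos_iff.1 (by rw [hcn]; exact one_pos)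
  have hcd : c * deriv f₀ 0 = ‖deriv f₀ 0‖ := by
    rw [hc, div_mul_eq_mul_div, ← Complex.normSq_eq_conj_mul_self, Complex.normSq_eq_norm_sq,
      div_eq_iff hrc]
    push_cast; ring
  set f : ℂ → ℂ := fun z => c * f₀ z with hfdef
  have hder : ∀ z ∈ D, HasDerivAt f (c * deriv f₀ z) z := fun z hz =>
    (hf₀.diff.differentiableAt (hD.mem_nhds hz)).hasDerivAt.const_mul c
  have hmaps : MapsTo f D (ball 0 1) := fun z hz => by
    have := hf₀.maps hz
    rw [mem_ball_zero_iff] at this ⊢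
    rwa [hfdef, norm_mul, hcn, one_mul]
  have hinj : InjOn f D := fun x hx y hy hxy => hf₀.inj hx hy (mul_left_cancel₀ hc0 hxy)
  have hsurj : SurjOn f D (ball 0 1) := by
    intro a ha
    by_contra hcon
    obtain ⟨F, hF, hlt⟩ := hf₀.exists_norm_deriv_lt hD hsc h0 (a := c⁻¹ * a)
      (by rwa [norm_mul, norm_inv, hcn, inv_one, one_mul, ← mem_ball_zero_iff])
      (by
        rintro ⟨z, hz, h⟩
        exact hcon ⟨z, hz, by rw [hfdef]; simp only; rw [h, mul_inv_cancel_left₀ hc0]⟩)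
    exact absurd hlt (not_lt.2 (hmax F hF))
  set φ := Function.invFunOn f D with hφ
  have hφD : MapsTo φ (ball 0 1) D := hsurj.mapsTo_invFunOn
  have hri : ∀ u ∈ ball (0 : ℂ) 1, f (φ u) = u := fun u hu => hsurj.rightInvOn_invFunOn hu
  have hli : ∀ z ∈ D, φ (f z) = z := fun z hz => hinj.leftInvOn_invFunOn hz
  have hne : ∀ z ∈ D, c * deriv f₀ z ≠ 0 := fun z hz => mul_ne_zero hc0 (hf₀.deriv_ne z hz)
  have hfdiff : DifferentiableOn ℂ f D := fun z hz =>
    (hder z hz).differentiableAt.differentiableWithinAt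
  have hφc : ∀ u ∈ ball (0 : ℂ) 1, ContinuousAt φ u := by
    intro u hu
    have h1 : map f (𝓝 (φ u)) = 𝓝 (f (φ u)) := by
      have h2 := (hfdiff.analyticAt (hD.mem_nhds (hφD hu))).hasStrictDerivAt
      refine h2.map_nhds_eq ?_
      rw [(hder _ (hφD hu)).deriv]
      exact hne _ (hφD hu)
    intro V hV
    have h3 : f '' (V ∩ D) ∈ 𝓝 u := by
      rw [← hri u hu, ← h1]
      exact image_mem_map (inter_mem hV (hD.mem_nhds (hφD hu)))
    rw [Filter.mem_map]
    filter_upwards [h3]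
    rintro _ ⟨z, ⟨hzV, hzD⟩, rfl⟩
    rw [mem_preimage, hli z hzD]
    exact hzV
  have hφd : ∀ u ∈ ball (0 : ℂ) 1, HasDerivAt φ (c * deriv f₀ (φ u))⁻¹ u := fun u hu =>
    HasDerivAt.of_local_left_inverse (hφc u hu) (hder _ (hφD hu)) (hne _ (hφD hu))
      (by filter_upwards [isOpen_ball.mem_nhds hu] with v hv using hri v hv)
  have hφ0 : φ 0 = 0 := by
    have := hli 0 h0
    rwa [hfdef, show (fun z => c * f₀ z) 0 = 0 by simp [hf₀.zero]] at this
  refine ⟨φ, f, ‖deriv f₀ 0‖⁻¹, fun u hu => (hφd u hu).differentiableAt.differentiableWithinAt,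
    hfdiff, hφD, hmaps, hri, hli, hφ0, ?_, inv_pos.2 hr⟩
  rw [(hφd 0 (mem_ball_self one_pos)).deriv, hφ0, hcd, Complex.ofReal_inv]

/-- A function on the plane, positive away from the origin and homogeneous under multiplication by
powers of `lam`, whose level sets are locally related by slides. -/
structure IsSlideFunction (lam : ℝ) (Q : ℂ → ℝ) : Prop where
  one_lt : 1 < lam
  contOn : ContinuousOn Q {0}ᶜ
  zero : Q 0 = 0
  pos : ∀ z, z ≠ 0 → 0 < Q z
  scale : ∀ z, Q (lam * z) = lam * Q z
  slide : ∀ b : ℝ, 0 < b → ∃ a c, 0 < a ∧ a < b ∧ b < c ∧ ∃ σ : ℝ → ℂ → ℂ,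
    ContinuousOn (fun x : ℝ × ℂ => σ x.1 x.2) (Ioo a c ×ˢ (Q ⁻¹' Ioo a c)) ∧
    ∀ t ∈ Ioo a c, ∀ z, Q z ∈ Ioo a c → Q (σ t z) = t ∧ σ (Q z) z = z

namespace IsSlideFunction

variable {lam : ℝ} {Q : ℂ → ℝ} (hQ : IsSlideFunction lam Q)
include hQ

theorem lam_pos : 0 < lam := one_pos.trans hQ.one_lt

theorem nonneg (z : ℂ) : 0 ≤ Q z := by
  rcases eq_or_ne z 0 with rfl | h
  · exact hQ.zero.ge
  · exact (hQ.pos z h).le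

theorem ne_zero_of_pos {z : ℂ} (h : 0 < Q z) : z ≠ 0 := by
  rintro rfl
  exact h.ne' hQ.zero

theorem scale_pow (n : ℕ) (z : ℂ) : Q ((lam : ℂ) ^ n * z) = lam ^ n * Q z := by
  induction n with
  | zero => simp
  | succ n ih => rw [pow_succ', mul_assoc, hQ.scale, ih]; ring

theorem scale_zpow (n : ℤ) (z : ℂ) : Q ((lam : ℂ) ^ n * z) = lam ^ n * Q z := by
  have hl : (lam : ℂ) ≠ 0 := Complex.ofReal_ne_zero.2 hQ.lam_pos.ne'
  obtain ⟨n, rfl | rfl⟩ := n.eq_nat_or_neg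
  · exact_mod_cast hQ.scale_pow n z
  · have h := hQ.scale_pow n ((lam : ℂ) ^ (-(n : ℤ)) * z)
    rw [← mul_assoc, zpow_neg, zpow_natCast, mul_inv_cancel₀ (pow_ne_zero _ hl), one_mul] at h
    rw [h, zpow_neg, zpow_natCast, zpow_neg, zpow_natCast,
      inv_mul_cancel_left₀ (pow_ne_zero _ hQ.lam_pos.ne')]

theorem exists_bounds : ∃ m M : ℝ, 0 < m ∧ 0 < M ∧ ∀ z, m * ‖z‖ ≤ Q z ∧ Q z ≤ M * ‖z‖ := by
  have hK : IsCompact (closedBall (0 : ℂ) lam \ ball 0 1) :=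
    (isCompact_closedBall _ _).diff isOpen_ball
  have hKc : ContinuousOn Q (closedBall (0 : ℂ) lam \ ball 0 1) := hQ.contOn.mono (by
    rintro z ⟨-, hz⟩ rfl
    exact hz (mem_ball_self one_pos))
  have hKn : (closedBall (0 : ℂ) lam \ ball 0 1).Nonempty :=
    ⟨1, by simpa using hQ.one_lt.le, by simp⟩
  obtain ⟨x, hx, hxm⟩ := hK.exists_isMinOn hKn hKc
  obtain ⟨y, hy, hyM⟩ := hK.exists_isMaxOn hKn hKc
  have hpos : ∀ w ∈ closedBall (0 : ℂ) lam \ ball 0 1, 0 < Q w := by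
    rintro w ⟨-, hw⟩
    refine hQ.pos w ?_
    rintro rfl
    exact hw (mem_ball_self one_pos)
  have hl := hQ.lam_pos
  refine ⟨Q x / lam, Q y, div_pos (hpos x hx) hl, hpos y hy, fun z => ?_⟩
  rcases eq_or_ne z 0 with rfl | hz
  · simp [hQ.zero]
  obtain ⟨n, hn1, hn2⟩ := exists_mem_Ico_zpow (norm_pos_iff.2 hz) hQ.one_lt
  set w : ℂ := (lam : ℂ) ^ (-n) * z with hw
  have hln : 0 < lam ^ n := zpow_pos hl n
  have hzw : z = (lam : ℂ) ^ n * w := by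
    rw [hw, ← mul_assoc, ← zpow_add₀ (Complex.ofReal_ne_zero.2 hl.ne')]
    simp
  have hnz : ‖z‖ = lam ^ n * ‖w‖ := by
    rw [hzw, norm_mul, norm_zpow, Complex.norm_real, Real.norm_of_nonneg hl.le]
  rw [hnz] at hn1 hn2
  rw [zpow_add₀ hl.ne', zpow_one] at hn2
  have h1 : 1 ≤ ‖w‖ := by
    by_contra! h
    nlinarith
  have h2 : ‖w‖ < lam := lt_of_mul_lt_mul_left hn2 hln.le
  have hwK : w ∈ closedBall (0 : ℂ) lam \ ball 0 1 := by
    refine ⟨mem_closedBall_zero_iff.2 h2.le, ?_⟩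
    rw [mem_ball_zero_iff]; exact not_lt.2 h1
  have h3 : Q x ≤ Q w := hxm hwK
  have h4 : Q w ≤ Q y := hyM hwK
  have h5 := hpos x hx
  have h6 := hpos y hy
  rw [hnz, hzw, hQ.scale_zpow]
  constructor
  · rw [mul_left_comm]
    gcongr
    rw [div_mul_eq_mul_div, div_le_iff₀ hl]
    nlinarith
  · rw [mul_left_comm]
    gcongr
    nlinarith

theorem continuous : Continuous Q := by
  obtain ⟨m, M, hm, hM, hb⟩ := hQ.exists_bounds
  rw [continuous_iff_continuousAt]
  intro z
  rcases eq_or_ne z 0 with rfl | hz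
  · rw [ContinuousAt, hQ.zero]
    refine squeeze_zero (fun z => hQ.nonneg z) (fun z => (hb z).2) ?_
    have : Tendsto (fun z : ℂ => M * ‖z‖) (𝓝 0) (𝓝 (M * ‖(0 : ℂ)‖)) :=
      (continuous_const.mul continuous_norm).tendsto 0
    simpa using this
  · exact hQ.contOn.continuousAt (isOpen_compl_singleton.mem_nhds hz)

theorem isOpen_sublevel (s : ℝ) : IsOpen {z | Q z < s} := isOpen_lt hQ.continuous continuous_const

theorem isBounded_sublevel_le (s : ℝ) : Bornology.IsBounded {z | Q z ≤ s} := by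
  obtain ⟨m, M, hm, hM, hb⟩ := hQ.exists_bounds
  refine (isBounded_closedBall (x := (0 : ℂ)) (r := s / m)).subset fun z hz => ?_
  rw [mem_closedBall_zero_iff, le_div_iff₀ hm, mul_comm]
  exact (hb z).1.trans hz

theorem isBounded_sublevel (s : ℝ) : Bornology.IsBounded {z | Q z < s} :=
  (hQ.isBounded_sublevel_le s).subset fun z (hz : Q z < s) => (le_of_lt hz : Q z ≤ s)

theorem isCompact_sublevel_le (s : ℝ) : IsCompact {z | Q z ≤ s} :=
  Metric.isCompact_of_isClosed_isBounded (isClosed_le hQ.continuous continuous_const)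
    (hQ.isBounded_sublevel_le s)

theorem exists_lt_of_mem_nhds {z : ℂ} (hz : z ≠ 0) {V : Set ℂ} (hV : V ∈ 𝓝 z) :
    ∃ w ∈ V, Q z < Q w := by
  obtain ⟨a, c, ha, hab, hbc, σ, hσ, hσQ⟩ := hQ.slide (Q z) (hQ.pos z hz)
  have hmem : (Q z, z) ∈ Ioo a c ×ˢ (Q ⁻¹' Ioo a c) := ⟨⟨hab, hbc⟩, ⟨hab, hbc⟩⟩
  have ho : IsOpen (Ioo a c ×ˢ (Q ⁻¹' Ioo a c)) :=
    isOpen_Ioo.prod (isOpen_Ioo.preimage hQ.continuous)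
  have h1 : ContinuousAt (fun x : ℝ × ℂ => σ x.1 x.2) (Q z, z) :=
    hσ.continuousAt (ho.mem_nhds hmem)
  have h2 : Tendsto (fun t : ℝ => σ t z) (𝓝 (Q z)) (𝓝 z) := by
    have h3 : Tendsto (fun t : ℝ => (t, z)) (𝓝 (Q z)) (𝓝 (Q z, z)) :=
      (Continuous.prodMk continuous_id continuous_const).tendsto _
    have := h1.tendsto.comp h3
    simp only [(hσQ _ hmem.1 z hmem.2).2] at this
    exact this
  obtain ⟨t, ⟨ht1, ht2⟩, ht3⟩ := ((((h2.mono_left nhdsWithin_le_nhds).eventually hV).and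
    (mem_nhdsWithin_of_mem_nhds (Ioo_mem_nhds hab hbc))).and
    (self_mem_nhdsWithin : Ioi (Q z) ∈ 𝓝[>] (Q z))).exists
  exact ⟨σ t z, ht1, by rw [(hσQ t ht2 z hmem.2).1]; exact ht3⟩

theorem nullhomotopic_inclusion {c s : ℝ} (hs : 0 < s)
    (hcs : {z | Q z < c} ⊆ {z | Q z < s}) {r : ℝ} (h1 : {z | Q z < c} ⊆ ball 0 r)
    (h2 : ball 0 r ⊆ {z | Q z < s}) : (ContinuousMap.inclusion hcs).Nullhomotopic := by
  refine ⟨⟨0, by simpa [hQ.zero] using hs⟩, ⟨⟨⟨fun x => ⟨((1 - (x.1 : ℝ) : ℝ) : ℂ) * x.2.1, ?_⟩, ?_⟩,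
    fun x => ?_, fun x => ?_⟩⟩⟩
  · refine h2 ?_
    have h3 := mem_ball_zero_iff.1 (h1 x.2.2)
    rw [mem_ball_zero_iff, norm_mul, Complex.norm_real, Real.norm_of_nonneg (by linarith [x.1.2.2])]
    exact (mul_le_of_le_one_left (norm_nonneg _) (by linarith [x.1.2.1])).trans_lt h3
  · fun_prop
  · ext; simp [ContinuousMap.inclusion]
  · ext; simp

theorem homotopic_inclusion {s c₁ c₂ d : ℝ} {a c : ℝ} {σ : ℝ → ℂ → ℂ}
    (hσ : ContinuousOn (fun x : ℝ × ℂ => σ x.1 x.2) (Ioo a c ×ˢ (Q ⁻¹' Ioo a c)))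
    (hσQ : ∀ t ∈ Ioo a c, ∀ z, Q z ∈ Ioo a c → Q (σ t z) = t ∧ σ (Q z) z = z)
    (ha1 : a < c₁) (h1d : c₁ < d) (h2c : c₂ ≤ c) (hc1c : c₁ < c)
    (h2s : {z | Q z < c₂} ⊆ {z | Q z < s}) (hds : {z | Q z < d} ⊆ {z | Q z < s})
    (hs2 : c₂ ≤ s) :
    ∃ g : C({z | Q z < c₂}, {z | Q z < d}),
      (ContinuousMap.inclusion h2s).Homotopic ((ContinuousMap.inclusion hds).comp g) := by
  classical
  have hQc := hQ.continuous
  set H : unitInterval × {z | Q z < c₂} → ℂ := fun x => if Q x.2.1 ≤ c₁ then x.2.1 else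
    σ ((1 - (x.1 : ℝ)) * Q x.2.1 + x.1 * c₁) x.2.1 with hH
  have hmem : ∀ x : unitInterval × {z | Q z < c₂}, c₁ ≤ Q x.2.1 →
      (1 - (x.1 : ℝ)) * Q x.2.1 + x.1 * c₁ ∈ Icc c₁ (Q x.2.1) := by
    intro x hx
    constructor <;> nlinarith [x.1.2.1, x.1.2.2]
  have hcont : Continuous H := by
    refine continuous_if_le (by fun_prop) continuous_const (by fun_prop) ?_ ?_
    · refine hσ.comp (f := fun x : unitInterval × {z | Q z < c₂} =>
        ((1 - (x.1 : ℝ)) * Q x.2.1 + x.1 * c₁, x.2.1)) (Continuous.continuousOn (by fun_prop)) ?_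
      intro x hx
      have h3 := hmem x hx
      have h4 : Q x.2.1 < c₂ := x.2.2
      exact ⟨⟨ha1.trans_le h3.1, h3.2.trans_lt (h4.trans_le h2c)⟩,
        ⟨ha1.trans_le hx, h4.trans_le h2c⟩⟩
    · intro x hx
      rw [show (1 - (x.1 : ℝ)) * Q x.2.1 + x.1 * c₁ = Q x.2.1 by rw [hx]; ring]
      exact (hσQ c₁ ⟨ha1, hc1c⟩ _ ⟨by rw [hx]; exact ha1, by rw [hx]; exact hc1c⟩).2.symm
  have hval : ∀ x : unitInterval × {z | Q z < c₂}, Q (H x) ≤ Q x.2.1 ∧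
      (x.1 = 0 → H x = x.2.1) ∧ (x.1 = 1 → Q (H x) ≤ c₁) := by
    intro x
    simp only [hH]
    split_ifs with h
    · exact ⟨le_rfl, fun _ => rfl, fun _ => h⟩
    · have h3 := hmem x (not_le.1 h).le
      have h4 : Q x.2.1 < c₂ := x.2.2
      have h5 := hσQ _ ⟨ha1.trans_le h3.1, h3.2.trans_lt (h4.trans_le h2c)⟩ x.2.1
        ⟨ha1.trans_le (not_le.1 h).le, h4.trans_le h2c⟩
      refine ⟨h5.1.trans_le h3.2, fun h0 => ?_, fun h0 => ?_⟩
      · rw [h0]; simpa using h5.2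
      · rw [h5.1, h0]; simp
  refine ⟨⟨fun z => ⟨H (1, z), ((hval (1, z)).2.2 rfl).trans_lt h1d⟩, by fun_prop⟩,
    ⟨⟨⟨fun x => ⟨H x, (hval x).1.trans_lt (lt_of_lt_of_le x.2.2 hs2)⟩, by fun_prop⟩,
      fun x => ?_, fun x => ?_⟩⟩⟩
  · ext
    exact (hval (0, x)).2.1 rfl
  · rfl

theorem isSimplyConnected_sublevel {s : ℝ} (hs : 0 < s) : IsSimplyConnected {z | Q z < s} := by
  have hsub : ∀ {c}, c ≤ s → {z | Q z < c} ⊆ {z | Q z < s} := fun hc z hz => lt_of_lt_of_le hz hc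
  set S : Set ℝ := {c | 0 < c ∧ ∃ h : c ≤ s, (ContinuousMap.inclusion (hsub h)).Nullhomotopic}
    with hS
  have hbase : ∃ c, c ∈ S := by
    obtain ⟨m, M, hm, hM, hb⟩ := hQ.exists_bounds
    have hc : 0 < min s (m * (s / M)) := by positivity
    refine ⟨min s (m * (s / M)), hc, min_le_left _ _,
      hQ.nullhomotopic_inclusion hs _ (r := s / M) (fun z hz => ?_) (fun z hz => ?_)⟩
    · have h1 : Q z < m * (s / M) := lt_of_lt_of_le hz (min_le_right _ _)
      rw [mem_ball_zero_iff]
      exact lt_of_mul_lt_mul_left ((hb z).1.trans_lt h1) hm.le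
    · rw [mem_ball_zero_iff, lt_div_iff₀ hM] at hz
      exact (hb z).2.trans_lt (by linarith)
  obtain ⟨c₀, hc₀⟩ := hbase
  have hbdd : BddAbove S := ⟨s, fun c hc => hc.2.1⟩
  set b := sSup S
  have hb0 : 0 < b := hc₀.1.trans_le (le_csSup hbdd hc₀)
  obtain ⟨a, c, ha, hab, hbc, σ, hσ, hσQ⟩ := hQ.slide b hb0
  obtain ⟨d, hdS, had⟩ := exists_lt_of_lt_csSup ⟨c₀, hc₀⟩ hab
  obtain ⟨hd0, hds, hd⟩ := hdS
  have hdb : d ≤ b := le_csSup hbdd ⟨hd0, hds, hd⟩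
  have hstep : ∀ c₂, 0 < c₂ → c₂ ≤ c → c₂ ≤ s → c₂ ∈ S := by
    intro c₂ h20 h2c h2s
    obtain ⟨g, hg⟩ := hQ.homotopic_inclusion hσ hσQ (c₁ := (a + d) / 2) (d := d) (s := s)
      (c₂ := c₂) (by linarith) (by linarith) h2c (by linarith)
      (hsub h2s) (hsub hds) h2s
    obtain ⟨y, hy⟩ := hd.comp_left g
    exact ⟨h20, h2s, y, hg.trans hy⟩
  have hbs : b ≤ s := csSup_le ⟨c₀, hc₀⟩ fun c hc => hc.2.1
  have hsS : s ∈ S := by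
    by_cases h : s ≤ c
    · exact hstep s hs h le_rfl
    · exact absurd (le_csSup hbdd (hstep c (hb0.trans hbc) le_rfl (not_le.1 h).le))
        (not_le.2 hbc)
  obtain ⟨-, h, hnull⟩ := hsS
  have hcontr : ContractibleSpace {z | Q z < s} :=
    (contractible_iff_id_nullhomotopic _).2 hnull
  exact SimplyConnectedSpace.ofContractible _

theorem exists_isRiemannMap_sublevel {s : ℝ} (hs : 0 < s) :
    ∃ φ f h, IsRiemannMap {z | Q z < s} φ f h :=
  exists_isRiemannMap (hQ.isOpen_sublevel s) (hQ.isBounded_sublevel s)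
    (hQ.isSimplyConnected_sublevel hs) (by simpa [hQ.zero] using hs)

end IsSlideFunction

theorem eq_mul_dslope {f : ℂ → ℂ} (h0 : f 0 = 0) (z : ℂ) : f z = z * dslope f 0 z := by
  have := sub_smul_dslope f 0 z
  rw [sub_zero, h0, sub_zero, smul_eq_mul] at this
  exact this.symm

namespace IsRiemannMap

variable {D : Set ℂ} {φ f : ℂ → ℂ} {h : ℝ} (R : IsRiemannMap D φ f h)
include R

theorem inv_zero : f 0 = 0 := by
  have := R.left_inv 0 (mem_ball_self one_pos)
  rwa [R.zero] at this

theorem zero_mem : (0 : ℂ) ∈ D := by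
  have := R.maps (mem_ball_self one_pos)
  rwa [R.zero] at this

theorem hasDerivAt_zero : HasDerivAt φ h 0 := by
  rw [← R.deriv_zero]
  exact (R.diff.differentiableAt (isOpen_ball.mem_nhds (mem_ball_self one_pos))).hasDerivAt

theorem hasDerivAt_inv (hD : IsOpen D) : HasDerivAt f (h : ℂ)⁻¹ 0 := by
  have h1 : HasDerivAt f (deriv f 0) 0 :=
    (R.diff_inv.differentiableAt (hD.mem_nhds R.zero_mem)).hasDerivAt
  have h2 : HasDerivAt (f ∘ φ) (deriv f 0 * h) 0 := by
    refine HasDerivAt.comp 0 ?_ R.hasDerivAt_zero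
    rwa [R.zero]
  have h3 : HasDerivAt (f ∘ φ) 1 0 := (hasDerivAt_id (0 : ℂ)).congr_of_eventuallyEq (by
    filter_upwards [isOpen_ball.mem_nhds (mem_ball_self (x := (0 : ℂ)) one_pos)] with u hu
      using R.left_inv u hu)
  rwa [← eq_inv_of_mul_eq_one_left (h2.unique h3)]

theorem dslope_mul_dslope (hD : IsOpen D) {u : ℂ} (hu : u ∈ ball (0 : ℂ) 1) :
    dslope f 0 (φ u) * dslope φ 0 u = 1 := by
  rcases eq_or_ne u 0 with rfl | hne
  · rw [R.zero, dslope_same, dslope_same, R.deriv_zero, (R.hasDerivAt_inv hD).deriv,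
      inv_mul_cancel₀ (Complex.ofReal_ne_zero.2 R.pos.ne')]
  · have h1 := eq_mul_dslope R.inv_zero (φ u)
    have h3 := eq_mul_dslope R.zero u
    rw [R.left_inv u hu] at h1
    have h2 : u * (dslope f 0 (φ u) * dslope φ 0 u) = u * 1 := by
      linear_combination -h1 - dslope f 0 (φ u) * h3
    exact mul_left_cancel₀ hne h2

theorem dslope_inv_ne_zero (hD : IsOpen D) {z : ℂ} (hz : z ∈ D) : dslope f 0 z ≠ 0 := by
  have := R.dslope_mul_dslope hD (R.maps_inv hz)
  rw [R.right_inv z hz] at this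
  exact left_ne_zero_of_mul_eq_one this

theorem differentiableOn_dslope : DifferentiableOn ℂ (dslope φ 0) (ball 0 1) :=
  (Complex.differentiableOn_dslope (isOpen_ball.mem_nhds (mem_ball_self one_pos))).2 R.diff

theorem differentiableOn_dslope_inv (hD : IsOpen D) : DifferentiableOn ℂ (dslope f 0) D :=
  (Complex.differentiableOn_dslope (hD.mem_nhds R.zero_mem)).2 R.diff_inv

theorem norm_deriv_le (hD : IsOpen D) {ψ : ℂ → ℂ} {ρ : ℝ} (hρ : 0 < ρ)
    (hψ : DifferentiableOn ℂ ψ (ball 0 ρ)) (hm : MapsTo ψ (ball 0 ρ) D) (h0 : ψ 0 = 0) :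
    ‖deriv ψ 0‖ ≤ h / ρ := by
  have hg : DifferentiableOn ℂ (f ∘ ψ) (ball 0 ρ) := R.diff_inv.comp hψ hm
  have h1 := Complex.norm_deriv_le_div_of_mapsTo_ball (R₂ := 1) hg (fun u hu => by
    rw [Function.comp, h0, R.inv_zero]
    exact ball_subset_closedBall (R.maps_inv (hm hu))) hρ
  have h2 : HasDerivAt ψ (deriv ψ 0) 0 :=
    (hψ.differentiableAt (isOpen_ball.mem_nhds (mem_ball_self hρ))).hasDerivAt
  have h3 : HasDerivAt (f ∘ ψ) ((h : ℂ)⁻¹ * deriv ψ 0) 0 := by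
    refine HasDerivAt.comp 0 ?_ h2
    rw [h0]
    exact R.hasDerivAt_inv hD
  rw [h3.deriv, norm_mul, norm_inv, Complex.norm_real, Real.norm_of_nonneg R.pos.le] at h1
  have hp := R.pos
  rw [inv_mul_le_iff₀ hp] at h1
  calc _ ≤ _ := h1
    _ = h / ρ := by ring

theorem eqOn_of_deriv_eq (hD : IsOpen D) {ψ : ℂ → ℂ}
    (hψ : DifferentiableOn ℂ ψ (ball 0 1)) (hm : MapsTo ψ (ball 0 1) D) (h0 : ψ 0 = 0)
    (hd : deriv ψ 0 = h) : EqOn ψ φ (ball 0 1) := by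
  have hg : DifferentiableOn ℂ (f ∘ ψ) (ball 0 1) := R.diff_inv.comp hψ hm
  have hz : (f ∘ ψ) 0 = 0 := by rw [Function.comp, h0, R.inv_zero]
  have h2 : HasDerivAt ψ (deriv ψ 0) 0 :=
    (hψ.differentiableAt (isOpen_ball.mem_nhds (mem_ball_self one_pos))).hasDerivAt
  have h3 : HasDerivAt (f ∘ ψ) ((h : ℂ)⁻¹ * deriv ψ 0) 0 := by
    refine HasDerivAt.comp 0 ?_ h2
    rw [h0]
    exact R.hasDerivAt_inv hD
  have h4 : dslope (f ∘ ψ) 0 0 = 1 := by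
    rw [dslope_same, h3.deriv, hd, inv_mul_cancel₀ (Complex.ofReal_ne_zero.2 R.pos.ne')]
  have h1 := Complex.affine_of_mapsTo_ball_of_norm_dslope_eq_div (R₂ := 1) hg (fun u hu => by
    rw [hz]
    exact ball_subset_closedBall (R.maps_inv (hm hu))) (mem_ball_self one_pos)
    (by rw [h4]; simp)
  intro u hu
  have h5 := h1 hu
  simp only [hz, h4, smul_eq_mul, mul_one, sub_zero, zero_add] at h5
  rw [← R.right_inv _ (hm hu)]
  exact congrArg φ h5

theorem norm_dslope_inv_le {D' : Set ℂ} {φ' f' : ℂ → ℂ} {h' : ℝ} (R' : IsRiemannMap D' φ' f' h')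
    (hD : IsOpen D) (hD' : IsOpen D') {ρ c : ℝ} (hρ : ρ ≤ 1)
    (hm : MapsTo φ (ball 0 ρ) D') (hc : ∀ u ∈ ball (0 : ℂ) ρ, ‖f' (φ u)‖ ≤ c)
    {ζ : ℂ} (hζ : ζ ∈ D) (hfζ : ‖f ζ‖ < ρ) :
    ‖dslope f' 0 ζ‖ ≤ c / ρ * ‖dslope f 0 ζ‖ := by
  have hρ0 : 0 < ρ := (norm_nonneg _).trans_lt hfζ
  have hg : DifferentiableOn ℂ (f' ∘ φ) (ball 0 ρ) :=
    R'.diff_inv.comp (R.diff.mono (ball_subset_ball hρ)) hm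
  have hz : (f' ∘ φ) 0 = 0 := by rw [Function.comp, R.zero, R'.inv_zero]
  have hub : f ζ ∈ ball (0 : ℂ) ρ := mem_ball_zero_iff.2 hfζ
  have h1 := Complex.norm_dslope_le_div_of_mapsTo_ball (R₂ := c) hg (fun u hu => by
    rw [hz, mem_closedBall_zero_iff]
    exact hc u hu) hub
  have h2 : dslope f' 0 ζ = dslope (f' ∘ φ) 0 (f ζ) * dslope f 0 ζ := by
    rcases eq_or_ne ζ 0 with rfl | hne
    · have h3 : HasDerivAt (f' ∘ φ) ((h' : ℂ)⁻¹ * h) 0 := by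
        refine HasDerivAt.comp 0 ?_ R.hasDerivAt_zero
        rw [R.zero]
        exact R'.hasDerivAt_inv hD'
      rw [R.inv_zero, dslope_same, dslope_same, dslope_same, h3.deriv, (R.hasDerivAt_inv hD).deriv,
        (R'.hasDerivAt_inv hD').deriv, mul_assoc,
        mul_inv_cancel₀ (Complex.ofReal_ne_zero.2 R.pos.ne'), mul_one]
    · have h3 := eq_mul_dslope hz (f ζ)
      rw [Function.comp, R.right_inv ζ hζ, eq_mul_dslope R'.inv_zero ζ] at h3
      refine mul_left_cancel₀ hne ?_
      rw [h3, eq_mul_dslope R.inv_zero ζ]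
      ring
  rw [h2, norm_mul]
  gcongr

end IsRiemannMap

/-- A choice of Riemann maps for the sublevel sets of a slide function. -/
structure IsRiemannFamily (lam : ℝ) (Q : ℂ → ℝ) (φ f : ℝ → ℂ → ℂ) (h : ℝ → ℝ) : Prop where
  isSlide : IsSlideFunction lam Q
  riemann : ∀ s, 0 < s → IsRiemannMap {z | Q z < s} (φ s) (f s) (h s)

theorem IsSlideFunction.exists_isRiemannFamily {lam : ℝ} {Q : ℂ → ℝ} (hQ : IsSlideFunction lam Q) :
    ∃ φ f h, IsRiemannFamily lam Q φ f h := by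
  have : ∀ s : ℝ, ∃ φ f h, 0 < s → IsRiemannMap {z | Q z < s} φ f h := by
    intro s
    by_cases hs : 0 < s
    · obtain ⟨φ, f, h, H⟩ := hQ.exists_isRiemannMap_sublevel hs
      exact ⟨φ, f, h, fun _ => H⟩
    · exact ⟨0, 0, 0, fun hs' => absurd hs' hs⟩
  choose φ f h H using this
  exact ⟨φ, f, h, hQ, H⟩

namespace IsRiemannFamily

variable {lam : ℝ} {Q : ℂ → ℝ} {φ f : ℝ → ℂ → ℂ} {h : ℝ → ℝ} (R : IsRiemannFamily lam Q φ f h)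
include R

theorem isOpen (s : ℝ) : IsOpen {z | Q z < s} := R.isSlide.isOpen_sublevel s

theorem eventually_mapsTo {s ρ : ℝ} (hs : 0 < s) (hρ : ρ < 1) :
    ∀ᶠ s' in 𝓝 s, 0 < s' ∧ MapsTo (φ s) (closedBall 0 ρ) {z | Q z < s'} := by
  rcases lt_or_ge ρ 0 with hρ0 | hρ0
  · filter_upwards [lt_mem_nhds hs] with s' hs'
    exact ⟨hs', by rw [closedBall_eq_empty.2 hρ0]; exact mapsTo_empty _ _⟩
  have hsub : closedBall (0 : ℂ) ρ ⊆ ball 0 1 := closedBall_subset_ball hρ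
  obtain ⟨u, hu, hum⟩ := (isCompact_closedBall (0 : ℂ) ρ).exists_isMaxOn
    ⟨0, mem_closedBall_self hρ0⟩
    (R.isSlide.continuous.comp_continuousOn ((R.riemann s hs).diff.continuousOn.mono hsub))
  have h1 : Q (φ s u) < s := (R.riemann s hs).maps (hsub hu)
  filter_upwards [lt_mem_nhds hs, lt_mem_nhds h1] with s' hs' hs''
  exact ⟨hs', fun v hv => lt_of_le_of_lt (hum hv) hs''⟩

theorem norm_dslope_le {m : ℝ} (hm : 0 < m) (hb : ∀ z, m * ‖z‖ ≤ Q z) {s : ℝ} (hs : 0 < s) {u : ℂ}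
    (hu : u ∈ ball (0 : ℂ) 1) : ‖dslope (φ s) 0 u‖ ≤ s / m := by
  have := Complex.norm_dslope_le_div_of_mapsTo_ball (R₂ := s / m) (R.riemann s hs).diff
    (fun v hv => by
      rw [(R.riemann s hs).zero, mem_closedBall_zero_iff, le_div_iff₀ hm, mul_comm]
      exact (hb _).trans ((R.riemann s hs).maps hv).le) hu
  simpa using this

theorem eqOn_of_tendsto {l : Ultrafilter ℝ} {s : ℝ} (hs : 0 < s) (hl : (l : Filter ℝ) ≤ 𝓝 s)
    {Ψ : ℂ → ℂ} (hΨ : TendstoLocallyUniformlyOn (fun s' => dslope (φ s') 0) Ψ l (ball 0 1)) :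
    EqOn Ψ (dslope (φ s) 0) (ball 0 1) := by
  have hls : ∀ᶠ s' in (l : Filter ℝ), 0 < s' := hl (lt_mem_nhds hs)
  have h0 : (0 : ℂ) ∈ ball (0 : ℂ) 1 := mem_ball_self one_pos
  have hΨd : DifferentiableOn ℂ Ψ (ball 0 1) := hΨ.differentiableOn
    (hls.mono fun s' hs' => (R.riemann s' hs').differentiableOn_dslope) isOpen_ball
  set ψ : ℂ → ℂ := fun u => u * Ψ u with hψ
  have hψd : DifferentiableOn ℂ ψ (ball 0 1) := differentiableOn_id.mul hΨd
  have hψ0 : ψ 0 = 0 := by simp [hψ]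
  have hψ' : deriv ψ 0 = Ψ 0 := by
    have := (hasDerivAt_id (0 : ℂ)).mul
      (hΨd.differentiableAt (isOpen_ball.mem_nhds h0)).hasDerivAt
    simpa using! this.deriv
  have hlim : ∀ u ∈ ball (0 : ℂ) 1, Tendsto (fun s' => φ s' u) l (𝓝 (ψ u)) := by
    intro u hu
    refine ((hΨ.tendsto_at hu).const_mul u).congr' ?_
    filter_upwards [hls] with s' hs' using (eq_mul_dslope (R.riemann s' hs').zero u).symm
  have hle : ∀ u ∈ ball (0 : ℂ) 1, Q (ψ u) ≤ s := by
    intro u hu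
    refine le_of_tendsto_of_tendsto ((R.isSlide.continuous.tendsto _).comp (hlim u hu)) hl ?_
    filter_upwards [hls] with s' hs' using ((R.riemann s' hs').maps hu).le
  have hh : Tendsto (fun s' => (h s' : ℂ)) l (𝓝 (Ψ 0)) := by
    refine (hΨ.tendsto_at h0).congr' ?_
    filter_upwards [hls] with s' hs'
    rw [dslope_same, (R.riemann s' hs').deriv_zero]
  have hhn : Tendsto h l (𝓝 ‖Ψ 0‖) := by
    refine hh.norm.congr' ?_
    filter_upwards [hls] with s' hs'
    rw [Complex.norm_real, Real.norm_of_nonneg (R.riemann s' hs').pos.le]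
  have hge : h s ≤ ‖Ψ 0‖ := by
    have hρ : ∀ ρ ∈ Ioo (0 : ℝ) 1, ρ * h s ≤ ‖Ψ 0‖ := by
      intro ρ hρ
      refine ge_of_tendsto hhn ?_
      filter_upwards [hl (R.eventually_mapsTo hs hρ.2)] with s' hs'
      have h1 := (R.riemann s' hs'.1).norm_deriv_le (R.isOpen s') hρ.1
        ((R.riemann s hs).diff.mono (ball_subset_ball hρ.2.le))
        (hs'.2.mono_left ball_subset_closedBall) (R.riemann s hs).zero
      rw [(R.riemann s hs).deriv_zero, Complex.norm_real,
        Real.norm_of_nonneg (R.riemann s hs).pos.le, le_div_iff₀ hρ.1] at h1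
      linarith
    have h2 : Tendsto (fun ρ : ℝ => ρ * h s) (𝓝[<] 1) (𝓝 (1 * h s)) :=
      ((continuous_id.mul continuous_const).tendsto 1).mono_left nhdsWithin_le_nhds
    rw [one_mul] at h2
    refine le_of_tendsto h2 ?_
    filter_upwards [Ioo_mem_nhdsLT (zero_lt_one' ℝ)] with ρ hρ' using hρ ρ hρ'
  have hpos : Ψ 0 ≠ 0 := norm_pos_iff.1 ((R.riemann s hs).pos.trans_le hge)
  have hmaps : MapsTo ψ (ball 0 1) {z | Q z < s} := by
    intro u hu
    refine lt_of_le_of_ne (hle u hu) fun heq => ?_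
    have hne : ψ u ≠ 0 := R.isSlide.ne_zero_of_pos (by rw [heq]; exact hs)
    rcases (hψd.analyticAt (isOpen_ball.mem_nhds hu)).eventually_constant_or_nhds_le_map_nhds
      with hc | hc
    · have h1 := AnalyticOnNhd.eqOn_of_preconnected_of_eventuallyEq
        (hψd.analyticOnNhd isOpen_ball) (analyticOnNhd_const (v := ψ u))
        (convex_ball (0 : ℂ) 1).isPreconnected hu hc
      have h2 : ψ =ᶠ[𝓝 0] fun _ => ψ u := by
        filter_upwards [isOpen_ball.mem_nhds h0] with v hv using h1 hv
      apply hpos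
      rw [← hψ', h2.deriv_eq, deriv_const]
    · obtain ⟨w, ⟨v, hv, rfl⟩, hw⟩ := R.isSlide.exists_lt_of_mem_nhds hne
        (hc (image_mem_map (isOpen_ball.mem_nhds hu)))
      rw [heq] at hw
      exact absurd (hle v hv) (not_le.2 hw)
  have hle' := (R.riemann s hs).norm_deriv_le (R.isOpen s) one_pos hψd hmaps hψ0
  rw [hψ', div_one] at hle'
  have hΨ0 : Ψ 0 = h s := by
    refine tendsto_nhds_unique hh ?_
    have h3 : ‖Ψ 0‖ = h s := le_antisymm hle' hge
    rw [h3] at hhn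
    exact (Complex.continuous_ofReal.tendsto _).comp hhn
  have heq := (R.riemann s hs).eqOn_of_deriv_eq (R.isOpen s) hψd hmaps hψ0 (by rw [hψ', hΨ0])
  intro u hu
  rcases eq_or_ne u 0 with rfl | hne
  · rw [hΨ0, dslope_same, (R.riemann s hs).deriv_zero]
  · refine mul_left_cancel₀ hne ?_
    rw [← eq_mul_dslope (R.riemann s hs).zero]
    exact heq hu

theorem continuousOn_dslope :
    ContinuousOn (fun x : ℝ × ℂ => dslope (φ x.1) 0 x.2) (Ioi 0 ×ˢ ball 0 1) := by
  intro x hx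
  obtain ⟨s, u⟩ := x
  obtain ⟨hs, hu⟩ := hx
  replace hs : 0 < s := hs
  refine ContinuousAt.continuousWithinAt ?_
  rw [ContinuousAt, tendsto_iff_ultrafilter]
  intro l hl
  obtain ⟨m, M, hm, hM, hb⟩ := R.isSlide.exists_bounds
  have hl1 : Tendsto Prod.fst (l : Filter (ℝ × ℂ)) (𝓝 s) :=
    (continuous_fst.tendsto (s, u)).mono_left hl
  have hl2 : Tendsto Prod.snd (l : Filter (ℝ × ℂ)) (𝓝 u) :=
    (continuous_snd.tendsto (s, u)).mono_left hl
  set l' : Ultrafilter ℝ := l.map Prod.fst with hl'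
  have hle : (l' : Filter ℝ) ≤ 𝓝 s := hl1
  have hev : ∀ᶠ s' in (l' : Filter ℝ), s' ∈ Ioo 0 (2 * s) :=
    hle (Ioo_mem_nhds hs (by linarith))
  obtain ⟨Ψ, hΨ⟩ := exists_tendstoLocallyUniformlyOn_of_norm_le l' (isOpen_ball (x := (0 : ℂ)))
    (F := fun s' => dslope (φ s') 0) (M := 2 * s / m)
    (hev.mono fun s' hs' => (R.riemann s' hs'.1).differentiableOn_dslope)
    (hev.mono fun s' hs' u hu => (R.norm_dslope_le hm (fun z => (hb z).1) hs'.1 hu).trans (by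
      gcongr; exact hs'.2.le))
  have heq := R.eqOn_of_tendsto hs hle hΨ
  have hΨ' : TendstoLocallyUniformlyOn (fun (x : ℝ × ℂ) => dslope (φ x.1) 0) Ψ l (ball 0 1) := by
    intro v hv z hz
    obtain ⟨t, ht, ht'⟩ := hΨ v hv z hz
    exact ⟨t, ht, ht'⟩
  have hcΨ : ContinuousWithinAt Ψ (ball 0 1) u :=
    ((R.riemann s hs).differentiableOn_dslope.continuousOn.congr heq) u hu
  have h3 := hΨ'.tendsto_comp hcΨ hu
    (tendsto_nhdsWithin_iff.2 ⟨hl2, hl2.eventually (isOpen_ball.mem_nhds hu)⟩)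
  rw [heq hu] at h3
  exact h3

theorem dslope_inv_strictAnti {s s' : ℝ} (hs : 0 < s) (hss : s < s') {ζ : ℂ} (hζ : Q ζ < s) :
    ‖dslope (f s') 0 ζ‖ < ‖dslope (f s) 0 ζ‖ := by
  have Rs := R.riemann s hs
  have Rs' := R.riemann s' (hs.trans hss)
  have hsub : {z | Q z ≤ s} ⊆ {z | Q z < s'} := fun z hz => lt_of_le_of_lt hz hss
  obtain ⟨x, hx, hxm⟩ := (R.isSlide.isCompact_sublevel_le s).exists_isMaxOn
    ⟨0, by simpa [R.isSlide.zero] using hs.le⟩ (Rs'.diff_inv.continuousOn.mono hsub).norm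
  have h1 : ‖f s' x‖ < 1 := mem_ball_zero_iff.1 (Rs'.maps_inv (hsub hx))
  have h2 := Rs.norm_dslope_inv_le Rs' (R.isOpen s) (R.isOpen s') le_rfl
    (fun u hu => lt_trans (Rs.maps hu) hss) (c := ‖f s' x‖)
    (fun u hu => hxm (show Q (φ s u) ≤ s from (Rs.maps hu).le)) hζ
    (mem_ball_zero_iff.1 (Rs.maps_inv hζ))
  have h3 : 0 < ‖dslope (f s) 0 ζ‖ := norm_pos_iff.2 (Rs.dslope_inv_ne_zero (R.isOpen s) hζ)
  rw [div_one] at h2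
  exact h2.trans_lt (mul_lt_of_lt_one_left h3 h1)

theorem eventually_norm_dslope_inv_lt {s : ℝ} (hs : 0 < s) {ζ : ℂ} (hζ : Q ζ < s) {C : ℝ}
    (hC : ‖dslope (f s) 0 ζ‖ < C) :
    ∀ᶠ s' in 𝓝 s, 0 < s' ∧ Q ζ < s' ∧ ‖dslope (f s') 0 ζ‖ < C := by
  have Rs := R.riemann s hs
  have hfζ : ‖f s ζ‖ < 1 := mem_ball_zero_iff.1 (Rs.maps_inv hζ)
  have h1 : Tendsto (fun ρ : ℝ => 1 / ρ * ‖dslope (f s) 0 ζ‖) (𝓝[<] 1)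
      (𝓝 (1 / 1 * ‖dslope (f s) 0 ζ‖)) :=
    (((continuousAt_const.div continuousAt_id one_ne_zero).mul continuousAt_const).tendsto).mono_left
      nhdsWithin_le_nhds
  rw [div_one, one_mul] at h1
  obtain ⟨ρ, hρC, hρ1, hρ2⟩ := ((h1.eventually (gt_mem_nhds hC)).and
    (Ioo_mem_nhdsLT hfζ)).exists
  filter_upwards [R.eventually_mapsTo hs hρ2, lt_mem_nhds hζ] with s' hs' hζ'
  refine ⟨hs'.1, hζ', ?_⟩
  have Rs' := R.riemann s' hs'.1
  have hm := hs'.2.mono_left (ball_subset_closedBall (x := (0 : ℂ)) (ε := ρ))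
  exact (Rs.norm_dslope_inv_le Rs' (R.isOpen s) (R.isOpen s') hρ2.le hm
    (fun u hu => (mem_ball_zero_iff.1 (Rs'.maps_inv (hm hu))).le) hζ hρ1).trans_lt hρC

theorem scale_h {s : ℝ} (hs : 0 < s) : h (lam * s) = lam * h s ∧
    EqOn (fun u => (lam : ℂ) * φ s u) (φ (lam * s)) (ball 0 1) := by
  have hl := R.isSlide.lam_pos
  have Rs := R.riemann s hs
  have Rl := R.riemann (lam * s) (by positivity)
  have hlc : (lam : ℂ) ≠ 0 := Complex.ofReal_ne_zero.2 hl.ne'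
  have hm : MapsTo (fun u => (lam : ℂ) * φ s u) (ball 0 1) {z | Q z < lam * s} := fun u hu => by
    rw [mem_ofPred_eq, R.isSlide.scale]
    exact mul_lt_mul_of_pos_left (Rs.maps hu) hl
  have hm' : MapsTo (fun u => (lam : ℂ)⁻¹ * φ (lam * s) u) (ball 0 1) {z | Q z < s} := fun u hu => by
    have h1 : Q (φ (lam * s) u) < lam * s := Rl.maps hu
    rw [mem_ofPred_eq]
    rw [← mul_inv_cancel_left₀ hlc (φ (lam * s) u), R.isSlide.scale] at h1
    exact lt_of_mul_lt_mul_left h1 hl.le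
  have hd := Rs.hasDerivAt_zero.const_mul (lam : ℂ)
  have hd' := Rl.hasDerivAt_zero.const_mul (lam : ℂ)⁻¹
  have h1 := Rl.norm_deriv_le (R.isOpen _) one_pos (Rs.diff.const_mul _) hm (by simp [Rs.zero])
  have h2 := Rs.norm_deriv_le (R.isOpen _) one_pos (Rl.diff.const_mul _) hm' (by simp [Rl.zero])
  rw [hd.deriv, div_one, norm_mul, Complex.norm_real, Complex.norm_real, Real.norm_of_nonneg hl.le,
    Real.norm_of_nonneg Rs.pos.le] at h1
  rw [hd'.deriv, div_one, norm_mul, norm_inv, Complex.norm_real, Complex.norm_real,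
    Real.norm_of_nonneg hl.le, Real.norm_of_nonneg Rl.pos.le, inv_mul_le_iff₀ hl] at h2
  have h3 : h (lam * s) = lam * h s := le_antisymm h2 h1
  refine ⟨h3, Rl.eqOn_of_deriv_eq (R.isOpen _) (Rs.diff.const_mul _) hm (by simp [Rs.zero]) ?_⟩
  rw [hd.deriv, h3, Complex.ofReal_mul]

theorem scale_dslope {s : ℝ} (hs : 0 < s) {u : ℂ} (hu : u ∈ ball (0 : ℂ) 1) :
    dslope (φ (lam * s)) 0 u = lam * dslope (φ s) 0 u := by
  have hl := R.isSlide.lam_pos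
  obtain ⟨h1, h2⟩ := R.scale_h hs
  rcases eq_or_ne u 0 with rfl | hne
  · rw [dslope_same, dslope_same, (R.riemann s hs).deriv_zero,
      (R.riemann (lam * s) (by positivity)).deriv_zero, h1, Complex.ofReal_mul]
  · refine mul_left_cancel₀ hne ?_
    rw [← eq_mul_dslope (R.riemann (lam * s) (by positivity)).zero, mul_left_comm,
      ← eq_mul_dslope (R.riemann s hs).zero]
    exact (h2 hu).symm

theorem scale_dslope_inv {s : ℝ} (hs : 0 < s) {z : ℂ} (hz : Q z < s) :
    dslope (f (lam * s)) 0 (lam * z) * lam = dslope (f s) 0 z := by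
  have hl := R.isSlide.lam_pos
  have Rs := R.riemann s hs
  have Rl := R.riemann (lam * s) (by positivity)
  have hu := Rs.maps_inv hz
  have h1 := Rl.dslope_mul_dslope (R.isOpen _) hu
  have h2 := Rs.dslope_mul_dslope (R.isOpen _) hu
  rw [← (R.scale_h hs).2 hu, R.scale_dslope hs hu] at h1
  simp only [Rs.right_inv z hz] at h1 h2
  refine mul_right_cancel₀ (right_ne_zero_of_mul_eq_one h2) ?_
  rw [h2, ← h1]; ring

end IsRiemannFamily

/-- The levels at which `(r, z)` lies strictly inside. -/
def levelSet (Q : ℂ → ℝ) (f : ℝ → ℂ → ℂ) (r : ℝ) (z : ℂ) : Set ℝ :=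
  {s | 0 < s ∧ Q (r * z) < s ∧ ‖dslope (f s) 0 (r * z)‖ * ‖z‖ < 1}

/-- The function whose level sets are the images of circles of radius `r` under the Riemann maps,
rescaled by `r`. -/
noncomputable def interp (Q : ℂ → ℝ) (f : ℝ → ℂ → ℂ) (r : ℝ) (z : ℂ) : ℝ :=
  sInf (levelSet Q f r z)

theorem bddBelow_levelSet (Q : ℂ → ℝ) (f : ℝ → ℂ → ℂ) (r : ℝ) (z : ℂ) :
    BddBelow (levelSet Q f r z) := ⟨0, fun _ hs => hs.1.le⟩

theorem interp_zero_congr (Q : ℂ → ℝ) (f : ℝ → ℂ → ℂ) {z z' : ℂ} (hzz : ‖z‖ = ‖z'‖) :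
    interp Q f 0 z = interp Q f 0 z' := by
  simp [interp, levelSet, hzz]

namespace IsRiemannFamily

variable {lam : ℝ} {Q : ℂ → ℝ} {φ f : ℝ → ℂ → ℂ} {h : ℝ → ℝ} (R : IsRiemannFamily lam Q φ f h)
include R

theorem mem_levelSet_of_lt {r s s' : ℝ} {z : ℂ} (hs : s ∈ levelSet Q f r z) (hss : s < s') :
    s' ∈ levelSet Q f r z := by
  obtain ⟨h1, h2, h3⟩ := hs
  refine ⟨h1.trans hss, h2.trans hss, lt_of_le_of_lt ?_ h3⟩
  gcongr
  exact (R.dslope_inv_strictAnti h1 hss h2).le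

theorem exists_lt_mem_levelSet {r s : ℝ} {z : ℂ} (hz : z ≠ 0) (hs : s ∈ levelSet Q f r z) :
    ∃ s' < s, s' ∈ levelSet Q f r z := by
  obtain ⟨h1, h2, h3⟩ := hs
  have hz' := norm_pos_iff.2 hz
  rw [← lt_div_iff₀ hz'] at h3
  obtain ⟨s', hs', hss⟩ := (((R.eventually_norm_dslope_inv_lt h1 h2 h3).filter_mono
    nhdsWithin_le_nhds).and (self_mem_nhdsWithin : Iio s ∈ 𝓝[<] s)).exists
  exact ⟨s', hss, hs'.1, hs'.2.1, (lt_div_iff₀ hz').1 hs'.2.2⟩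

theorem levelSet_nonempty {r : ℝ} (hr : r ∈ Icc (0 : ℝ) 1) (z : ℂ) :
    (levelSet Q f r z).Nonempty := by
  obtain ⟨m, M, hm, hM, hb⟩ := R.isSlide.exists_bounds
  set s := M * (‖z‖ + 1)
  have hs : 0 < s := by positivity
  have hrz : ‖(r : ℂ) * z‖ ≤ ‖z‖ := by
    rw [norm_mul, Complex.norm_real, Real.norm_of_nonneg hr.1]
    exact mul_le_of_le_one_left (norm_nonneg _) hr.2
  have hsub : ball (0 : ℂ) (‖z‖ + 1) ⊆ {z | Q z < s} := fun w hw =>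
    (hb w).2.trans_lt (mul_lt_mul_of_pos_left (mem_ball_zero_iff.1 hw) hM)
  have hmem : (r : ℂ) * z ∈ ball (0 : ℂ) (‖z‖ + 1) := mem_ball_zero_iff.2 (by linarith)
  refine ⟨s, hs, hsub hmem, ?_⟩
  have h1 := Complex.norm_dslope_le_div_of_mapsTo_ball (R₂ := 1)
    ((R.riemann s hs).diff_inv.mono hsub) (fun w hw => by
      rw [(R.riemann s hs).inv_zero]
      exact ball_subset_closedBall ((R.riemann s hs).maps_inv (hsub hw))) hmem
  calc _ ≤ 1 / (‖z‖ + 1) * ‖z‖ := by gcongr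
    _ < 1 := by
      rw [one_div_mul_eq_div, div_lt_one (by positivity)]
      linarith

theorem interp_lt_iff {r : ℝ} (hr : r ∈ Icc (0 : ℝ) 1) {z : ℂ} (hz : z ≠ 0) {s : ℝ} :
    interp Q f r z < s ↔ s ∈ levelSet Q f r z := by
  constructor
  · intro hs
    obtain ⟨s', hs', hss⟩ := exists_lt_of_csInf_lt (R.levelSet_nonempty hr z) hs
    exact R.mem_levelSet_of_lt hs' hss
  · intro hs
    obtain ⟨s', hss, hs'⟩ := R.exists_lt_mem_levelSet hz hs
    exact (csInf_le (bddBelow_levelSet Q f r z) hs').trans_lt hss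

theorem interp_pos {r : ℝ} (hr : r ∈ Icc (0 : ℝ) 1) {z : ℂ} (hz : z ≠ 0) : 0 < interp Q f r z := by
  obtain ⟨m, M, hm, hM, hb⟩ := R.isSlide.exists_bounds
  have hz' := norm_pos_iff.2 hz
  refine lt_of_lt_of_le (mul_pos hm hz') (le_csInf (R.levelSet_nonempty hr z) ?_)
  rintro s ⟨h1, h2, h3⟩
  have Rs := R.riemann s h1
  have h4 := Rs.dslope_mul_dslope (R.isOpen s) (Rs.maps_inv h2)
  rw [Rs.right_inv _ h2] at h4
  have h5 := R.norm_dslope_le hm (fun z => (hb z).1) h1 (Rs.maps_inv h2)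
  have h6 : ‖dslope (f s) 0 (r * z)‖ * ‖dslope (φ s) 0 (f s (r * z))‖ = 1 := by
    rw [← norm_mul, h4, norm_one]
  by_contra! hcon
  rw [le_div_iff₀ hm] at h5
  have h7 : 0 < ‖dslope (f s) 0 (r * z)‖ := norm_pos_iff.2 (left_ne_zero_of_mul_eq_one h4)
  nlinarith [mul_lt_mul_of_pos_left hcon h7]

theorem interp_scale {r : ℝ} (hr : r ∈ Icc (0 : ℝ) 1) {z : ℂ} (hz : z ≠ 0) :
    interp Q f r (lam * z) = lam * interp Q f r z := by
  have hl := R.isSlide.lam_pos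
  have hlz : (lam : ℂ) * z ≠ 0 := mul_ne_zero (Complex.ofReal_ne_zero.2 hl.ne') hz
  have key : ∀ s : ℝ, lam * s ∈ levelSet Q f r (lam * z) ↔ s ∈ levelSet Q f r z := by
    intro s
    simp only [levelSet, mem_ofPred_eq, mul_left_comm (r : ℂ), R.isSlide.scale,
      mul_pos_iff_of_pos_left hl, mul_lt_mul_iff_right₀ hl]
    refine and_congr_right fun hs => and_congr_right fun hQs => ?_
    rw [← R.scale_dslope_inv hs hQs, norm_mul, norm_mul, mul_assoc]
  refine eq_of_forall_gt_iff fun s => ?_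
  obtain ⟨t, rfl⟩ : ∃ t, s = lam * t := ⟨s / lam, by field_simp⟩
  rw [R.interp_lt_iff hr hlz, key, ← R.interp_lt_iff hr hz, mul_lt_mul_iff_right₀ hl]

theorem interp_one {z : ℂ} (hz : z ≠ 0) : interp Q f 1 z = Q z := by
  refine eq_of_forall_gt_iff fun s => ?_
  rw [R.interp_lt_iff ⟨zero_le_one, le_rfl⟩ hz]
  simp only [levelSet, mem_ofPred_eq, Complex.ofReal_one, one_mul]
  refine ⟨fun hs => hs.2.1, fun hs => ?_⟩
  have hs0 : 0 < s := (R.isSlide.nonneg z).trans_lt hs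
  refine ⟨hs0, hs, ?_⟩
  have Rs := R.riemann s hs0
  rw [← norm_mul, mul_comm, ← eq_mul_dslope Rs.inv_zero]
  exact mem_ball_zero_iff.1 (Rs.maps_inv hs)

theorem continuousOn_interp :
    ContinuousOn (fun x : ℝ × ℂ => interp Q f x.1 x.2) (Icc 0 1 ×ˢ {0}ᶜ) := by
  rintro ⟨r, z⟩ ⟨hr, hz⟩
  replace hz : z ≠ 0 := hz
  replace hr : r ∈ Icc (0 : ℝ) 1 := hr
  have hcm : Continuous fun x : ℝ × ℂ => (x.1 : ℂ) * x.2 := by fun_prop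
  have hcQ : Continuous fun x : ℝ × ℂ => Q (x.1 * x.2) := R.isSlide.continuous.comp hcm
  have hck : ∀ s : ℝ, 0 < s → Q (r * z) < s → ContinuousAt
      (fun x : ℝ × ℂ => ‖dslope (f s) 0 (x.1 * x.2)‖ * ‖x.2‖) (r, z) := by
    intro s hs hQs
    have h1 : ContinuousAt (dslope (f s) 0) (r * z) :=
      ((R.riemann s hs).differentiableOn_dslope_inv (R.isOpen s)).continuousOn.continuousAt
        ((R.isOpen s).mem_nhds hQs)
    have h2 : ContinuousAt (fun x : ℝ × ℂ => dslope (f s) 0 (x.1 * x.2)) (r, z) :=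
      ContinuousAt.comp' (f := fun x : ℝ × ℂ => (x.1 : ℂ) * x.2) h1 hcm.continuousAt
    exact h2.norm.mul continuousAt_snd.norm
  refine tendsto_order.2 ⟨fun b hb => ?_, fun b hb => ?_⟩
  · simp only at hb
    obtain ⟨b₁, hb1, hb1'⟩ := exists_between (max_lt hb (R.interp_pos hr hz))
    obtain ⟨b₂, hb2, hb2'⟩ := exists_between hb1'
    have hb0 : 0 < b₁ := (le_max_right _ _).trans_lt hb1
    have hbb : b < b₁ := (le_max_left _ _).trans_lt hb1
    rcases lt_or_ge b₁ (Q (r * z)) with hc | hc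
    · filter_upwards [mem_nhdsWithin_of_mem_nhds (hcQ.continuousAt.eventually (lt_mem_nhds hc)),
        self_mem_nhdsWithin] with y hy hyS
      refine hbb.trans_le (not_lt.1 fun hcon => ?_)
      exact lt_asymm hy ((R.interp_lt_iff hyS.1 hyS.2).1 hcon).2.1
    · obtain ⟨b₃, hb3, hb3'⟩ := exists_between hb2
      have h30 : 0 < b₃ := hb0.trans hb3
      have hQ3 : Q (r * z) < b₃ := hc.trans_lt hb3
      have h2n : b₂ ∉ levelSet Q f r z := fun hm =>
        lt_asymm hb2' ((R.interp_lt_iff hr hz).2 hm)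
      have h4 : 1 ≤ ‖dslope (f b₂) 0 (r * z)‖ * ‖z‖ := not_lt.1 fun hm =>
        h2n ⟨h30.trans hb3', hQ3.trans hb3', hm⟩
      have h5 : 1 < ‖dslope (f b₃) 0 (r * z)‖ * ‖z‖ := h4.trans_lt
        (mul_lt_mul_of_pos_right (R.dslope_inv_strictAnti h30 hb3' hQ3) (norm_pos_iff.2 hz))
      filter_upwards [mem_nhdsWithin_of_mem_nhds ((hck b₃ h30 hQ3).eventually (lt_mem_nhds h5)),
        self_mem_nhdsWithin] with y hy hyS
      refine (hbb.trans hb3).trans_le (not_lt.1 fun hcon => ?_)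
      exact lt_asymm hy ((R.interp_lt_iff hyS.1 hyS.2).1 hcon).2.2
  · obtain ⟨h1, h2, h3⟩ := (R.interp_lt_iff hr hz).1 hb
    filter_upwards [mem_nhdsWithin_of_mem_nhds ((hck b h1 h2).eventually (gt_mem_nhds h3)),
      mem_nhdsWithin_of_mem_nhds (hcQ.continuousAt.eventually (gt_mem_nhds h2)),
        self_mem_nhdsWithin] with y hy hy' hyS
    exact (R.interp_lt_iff hyS.1 hyS.2).2 ⟨h1, hy', hy⟩

end IsRiemannFamily

/-- The image of `w` under the Riemann map of level `s` precomposed with scaling by `r` and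
rescaled by `r⁻¹`. -/
noncomputable def interpParam (φ : ℝ → ℂ → ℂ) (r s : ℝ) (w : ℂ) : ℂ := dslope (φ s) 0 (r * w) * w

theorem norm_ofReal_mul_lt_one {r : ℝ} (hr : r ∈ Ico (0 : ℝ) 1) {w : ℂ} (hw : ‖w‖ ≤ 1) :
    (r : ℂ) * w ∈ ball (0 : ℂ) 1 := by
  rw [mem_ball_zero_iff, norm_mul, Complex.norm_real, Real.norm_of_nonneg hr.1]
  exact (mul_le_of_le_one_right hr.1 hw).trans_lt hr.2

namespace IsRiemannFamily

variable {lam : ℝ} {Q : ℂ → ℝ} {φ f : ℝ → ℂ → ℂ} {h : ℝ → ℝ} (R : IsRiemannFamily lam Q φ f h)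
include R

theorem continuousOn_interpParam {r : ℝ} (hr : r ∈ Ico (0 : ℝ) 1) :
    ContinuousOn (fun x : ℝ × ℂ => interpParam φ r x.1 x.2) (Ioi 0 ×ˢ closedBall 0 1) := by
  have h1 : ContinuousOn (fun x : ℝ × ℂ => dslope (φ x.1) 0 (r * x.2)) (Ioi 0 ×ˢ closedBall 0 1) :=
    R.continuousOn_dslope.comp (f := fun x : ℝ × ℂ => (x.1, (r : ℂ) * x.2))
      (by fun_prop) fun x hx => ⟨hx.1, norm_ofReal_mul_lt_one hr (mem_closedBall_zero_iff.1 hx.2)⟩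
  exact h1.mul continuous_snd.continuousOn

theorem mul_interpParam (r : ℝ) {s : ℝ} (hs : 0 < s) (w : ℂ) :
    r * interpParam φ r s w = φ s (r * w) := by
  rw [eq_mul_dslope (R.riemann s hs).zero, interpParam]; ring

theorem dslope_inv_mul_interpParam {r : ℝ} (hr : r ∈ Ico (0 : ℝ) 1) {s : ℝ} (hs : 0 < s) {w : ℂ}
    (hw : ‖w‖ ≤ 1) : dslope (f s) 0 (r * interpParam φ r s w) * interpParam φ r s w = w := by
  have h1 := (R.riemann s hs).dslope_mul_dslope (R.isOpen s) (norm_ofReal_mul_lt_one hr hw)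
  rw [R.mul_interpParam r hs, interpParam, ← mul_assoc, h1, one_mul]

theorem apply_mul_interpParam_lt {r : ℝ} (hr : r ∈ Ico (0 : ℝ) 1) {s : ℝ} (hs : 0 < s) {w : ℂ}
    (hw : ‖w‖ ≤ 1) : Q (r * interpParam φ r s w) < s := by
  rw [R.mul_interpParam r hs]
  exact (R.riemann s hs).maps (norm_ofReal_mul_lt_one hr hw)

theorem interpParam_ne_zero {r : ℝ} (hr : r ∈ Ico (0 : ℝ) 1) {s : ℝ} (hs : 0 < s) {w : ℂ}
    (hw : ‖w‖ = 1) : interpParam φ r s w ≠ 0 := by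
  intro h0
  have := R.dslope_inv_mul_interpParam hr hs hw.le
  rw [h0, mul_zero] at this
  simp [← this] at hw

theorem interp_interpParam {r : ℝ} (hr : r ∈ Ico (0 : ℝ) 1) {s : ℝ} (hs : 0 < s) {w : ℂ}
    (hw : ‖w‖ = 1) : interp Q f r (interpParam φ r s w) = s := by
  have h0 := R.interpParam_ne_zero hr hs hw
  have h1 : ‖dslope (f s) 0 (r * interpParam φ r s w)‖ * ‖interpParam φ r s w‖ = 1 := by
    rw [← norm_mul, R.dslope_inv_mul_interpParam hr hs hw.le, hw]
  have hQ := R.apply_mul_interpParam_lt hr hs hw.le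
  refine eq_of_forall_gt_iff fun a => ?_
  rw [R.interp_lt_iff ⟨hr.1, hr.2.le⟩ h0]
  refine ⟨fun ha => ?_, fun ha => ⟨hs.trans ha, hQ.trans ha, ?_⟩⟩
  · by_contra! hcon
    rcases hcon.lt_or_eq with hlt | rfl
    · exact (R.mem_levelSet_of_lt ha hlt).2.2.ne h1
    · exact ha.2.2.ne h1
  · rw [← h1]
    exact mul_lt_mul_of_pos_right (R.dslope_inv_strictAnti hs ha hQ) (norm_pos_iff.2 h0)

theorem interpParam_scale {r : ℝ} (hr : r ∈ Ico (0 : ℝ) 1) {s : ℝ} (hs : 0 < s) {w : ℂ}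
    (hw : ‖w‖ ≤ 1) : interpParam φ r (lam * s) w = lam * interpParam φ r s w := by
  rw [interpParam, R.scale_dslope hs (norm_ofReal_mul_lt_one hr hw), interpParam, mul_assoc]

theorem interpParam_injOn {r : ℝ} (hr : r ∈ Ico (0 : ℝ) 1) {s : ℝ} (hs : 0 < s) :
    InjOn (interpParam φ r s) (closedBall 0 1) := by
  intro w hw w' hw' hww
  rw [← R.dslope_inv_mul_interpParam hr hs (mem_closedBall_zero_iff.1 hw), hww,
    R.dslope_inv_mul_interpParam hr hs (mem_closedBall_zero_iff.1 hw')]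

theorem exists_interpParam_eq_of_mem {r : ℝ} {s : ℝ} {z : ℂ} (hs : s ∈ levelSet Q f r z) :
    ∃ w, ‖w‖ < 1 ∧ interpParam φ r s w = z := by
  obtain ⟨h1, h2, h3⟩ := hs
  have Rs := R.riemann s h1
  refine ⟨dslope (f s) 0 (r * z) * z, by rwa [norm_mul], ?_⟩
  have h4 : (r : ℂ) * (dslope (f s) 0 (r * z) * z) = f s (r * z) := by
    rw [eq_mul_dslope Rs.inv_zero]; ring
  have h5 := Rs.dslope_mul_dslope (R.isOpen s) (Rs.maps_inv h2)
  rw [Rs.right_inv _ h2] at h5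
  rw [interpParam, h4, ← mul_assoc, mul_comm (dslope (φ s) 0 _), h5, one_mul]

theorem exists_interpParam_eq {r : ℝ} (hr : r ∈ Ico (0 : ℝ) 1) {z : ℂ} (hz : z ≠ 0) :
    ∃ w ∈ sphere (0 : ℂ) 1, interpParam φ r (interp Q f r z) w = z := by
  have hr' : r ∈ Icc (0 : ℝ) 1 := ⟨hr.1, hr.2.le⟩
  set s := interp Q f r z with hs
  have hs0 : 0 < s := R.interp_pos hr' hz
  have hmem : ∀ n : ℕ, s + 1 / ((n : ℝ) + 1) ∈ levelSet Q f r z := fun n =>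
    (R.interp_lt_iff hr' hz).1 (lt_add_of_pos_right _ (by positivity))
  choose w hw hwz using fun n => R.exists_interpParam_eq_of_mem (hmem n)
  obtain ⟨w₀, hw₀, ψ, hψ, hlim⟩ := (isCompact_closedBall (0 : ℂ) 1).tendsto_subseq
    (x := w) fun n => mem_closedBall_zero_iff.2 (hw n).le
  have hst : Tendsto (fun n : ℕ => s + 1 / ((n : ℝ) + 1)) atTop (𝓝 s) := by
    simpa using (tendsto_one_div_add_atTop_nhds_zero_nat (𝕜 := ℝ)).const_add s
  have hpair : Tendsto (fun n => (s + 1 / ((ψ n : ℝ) + 1), w (ψ n))) atTop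
      (𝓝[Ioi 0 ×ˢ closedBall 0 1] (s, w₀)) := by
    refine tendsto_nhdsWithin_iff.2 ⟨(hst.comp hψ.tendsto_atTop).prodMk_nhds hlim, ?_⟩
    exact Eventually.of_forall fun n => ⟨(hmem _).1, mem_closedBall_zero_iff.2 (hw _).le⟩
  have h1 := (R.continuousOn_interpParam hr (s, w₀) ⟨hs0, hw₀⟩).tendsto.comp hpair
  have h2 : interpParam φ r s w₀ = z := by
    refine (tendsto_nhds_unique (tendsto_const_nhds.congr fun n => ?_) h1).symm
    exact (hwz (ψ n)).symm
  refine ⟨w₀, ?_, h2⟩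
  rw [mem_closedBall_zero_iff] at hw₀
  rw [mem_sphere_zero_iff_norm]
  refine hw₀.antisymm (not_lt.1 fun hlt => ?_)
  have h3 := R.dslope_inv_mul_interpParam hr hs0 hw₀
  have h4 := R.apply_mul_interpParam_lt hr hs0 hw₀
  rw [h2] at h3 h4
  rw [← h3, norm_mul] at hlt
  exact lt_irrefl s ((R.interp_lt_iff hr' hz).2 ⟨hs0, h4, hlt⟩)

theorem interp_zero_lt {z z' : ℂ} (hz : z ≠ 0) (hzz : ‖z‖ < ‖z'‖) :
    interp Q f 0 z < interp Q f 0 z' := by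
  have h0 : (0 : ℝ) ∈ Icc (0 : ℝ) 1 := ⟨le_rfl, zero_le_one⟩
  have hz' : z' ≠ 0 := norm_pos_iff.1 ((norm_nonneg _).trans_lt hzz)
  obtain ⟨w, hw, hwz⟩ := R.exists_interpParam_eq ⟨le_rfl, zero_lt_one⟩ hz'
  have hs0 := R.interp_pos h0 hz'
  have h3 := R.dslope_inv_mul_interpParam ⟨le_rfl, zero_lt_one⟩ hs0 (mem_sphere_zero_iff_norm.1 hw).le
  have hw' := mem_sphere_zero_iff_norm.1 hw
  rw [← h3, hwz, norm_mul] at hw'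
  rw [R.interp_lt_iff h0 hz]
  have h4 : Q 0 < interp Q f 0 z' := by rwa [R.isSlide.zero]
  refine ⟨hs0, by simpa using h4, ?_⟩
  rw [← hw']
  simp only [Complex.ofReal_zero, zero_mul] at hw' ⊢
  refine mul_lt_mul_of_pos_left hzz ?_
  exact norm_pos_iff.2 ((R.riemann _ hs0).dslope_inv_ne_zero (R.isOpen _) h4)

end IsRiemannFamily

theorem IsSlideFunction.exists_interpolation {lam : ℝ} {Q : ℂ → ℝ} (hQ : IsSlideFunction lam Q) :
    ∃ P : ℝ → ℂ → ℝ, ContinuousOn (fun x : ℝ × ℂ => P x.1 x.2) (Icc 0 1 ×ˢ {0}ᶜ) ∧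
      (∀ z, z ≠ 0 → P 1 z = Q z) ∧
      (∀ r ∈ Icc (0 : ℝ) 1, ∀ z, z ≠ 0 → 0 < P r z ∧ P r (lam * z) = lam * P r z) ∧
      (∀ z z', z ≠ 0 → ‖z‖ < ‖z'‖ → P 0 z < P 0 z') ∧ (∀ z z', ‖z‖ = ‖z'‖ → P 0 z = P 0 z') ∧
      ∀ r ∈ Ico (0 : ℝ) 1, ∃ Θ : ℝ → ℂ → ℂ,
        ContinuousOn (fun x : ℝ × ℂ => Θ x.1 x.2) (Ioi 0 ×ˢ sphere 0 1) ∧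
        (∀ s, 0 < s → ∀ w ∈ sphere (0 : ℂ) 1, Θ s w ≠ 0 ∧ P r (Θ s w) = s ∧
          Θ (lam * s) w = lam * Θ s w ∧ ∀ w' ∈ sphere (0 : ℂ) 1, Θ s w = Θ s w' → w = w') ∧
        ∀ z, z ≠ 0 → ∃ w ∈ sphere (0 : ℂ) 1, Θ (P r z) w = z := by
  obtain ⟨φ, f, h, R⟩ := hQ.exists_isRiemannFamily
  refine ⟨interp Q f, R.continuousOn_interp, fun z hz => R.interp_one hz,
    fun r hr z hz => ⟨R.interp_pos hr hz, R.interp_scale hr hz⟩, fun z z' => R.interp_zero_lt,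
    fun z z' => interp_zero_congr Q f, fun r hr => ⟨interpParam φ r, ?_, fun s hs w hw => ?_,
      fun z hz => R.exists_interpParam_eq hr hz⟩⟩
  · exact (R.continuousOn_interpParam hr).mono (prod_mono subset_rfl sphere_subset_closedBall)
  · have hw' := mem_sphere_zero_iff_norm.1 hw
    exact ⟨R.interpParam_ne_zero hr hs hw', R.interp_interpParam hr hs hw',
      R.interpParam_scale hr hs hw'.le, fun w' hw'' hww => R.interpParam_injOn hr hs
        (sphere_subset_closedBall hw) (sphere_subset_closedBall hw'') hww⟩

/-- The infinite cylinder. -/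
abbrev Cyl : Type := ℝ × AddCircle (1 : ℝ)

/-- The identification of the cylinder with the punctured plane. -/
noncomputable def cylExp (y : Cyl) : ℂ := (Real.exp (2 * Real.pi * y.1) : ℂ) * y.2.toCircle

/-- The inverse of `cylExp`. -/
noncomputable def cylLog (z : ℂ) : Cyl :=
  (Real.log ‖z‖ / (2 * Real.pi), ((Complex.arg z / (2 * Real.pi) : ℝ) : AddCircle (1 : ℝ)))

theorem norm_cylExp (y : Cyl) : ‖cylExp y‖ = Real.exp (2 * Real.pi * y.1) := by
  rw [cylExp, norm_mul, Circle.norm_coe, mul_one, Complex.norm_real, Real.norm_eq_abs,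
    Real.abs_exp]

theorem cylExp_ne_zero (y : Cyl) : cylExp y ≠ 0 := by
  rw [← norm_pos_iff, norm_cylExp]; exact Real.exp_pos _

theorem continuous_cylExp : Continuous cylExp := by
  have h : Continuous fun y : Cyl => (y.2.toCircle : ℂ) :=
    continuous_subtype_val.comp (AddCircle.continuous_toCircle.comp continuous_snd)
  exact Continuous.mul (by fun_prop) h

theorem cylExp_add_one (x : ℝ) (θ : AddCircle (1 : ℝ)) :
    cylExp (x + 1, θ) = (Real.exp (2 * Real.pi) : ℝ) * cylExp (x, θ) := by
  simp only [cylExp]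
  rw [mul_add, mul_one, Real.exp_add]
  push_cast; ring

theorem cylExp_cylLog {z : ℂ} (hz : z ≠ 0) : cylExp (cylLog z) = z := by
  have h1 : 2 * Real.pi * (Real.log ‖z‖ / (2 * Real.pi)) = Real.log ‖z‖ := by
    field_simp
  have h2 : 2 * Real.pi / 1 * (Complex.arg z / (2 * Real.pi)) = Complex.arg z := by
    field_simp
  simp only [cylExp, cylLog]
  rw [h1, Real.exp_log (norm_pos_iff.2 hz), AddCircle.toCircle_apply_mk, h2, Circle.coe_exp,
    Complex.norm_mul_exp_arg_mul_I]

theorem fst_cylLog_cylExp (y : Cyl) : (cylLog (cylExp y)).1 = y.1 := by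
  simp only [cylLog]
  rw [norm_cylExp, Real.log_exp]
  field_simp

theorem cylLog_cylExp (y : Cyl) : cylLog (cylExp y) = y := by
  have h1 := fst_cylLog_cylExp y
  refine Prod.ext h1 (AddCircle.injective_toCircle one_ne_zero (Subtype.ext ?_))
  have h2 := cylExp_cylLog (cylExp_ne_zero y)
  rw [cylExp.eq_1 (cylLog _), cylExp.eq_1 y, ← cylExp.eq_1 y, h1] at h2
  exact mul_left_cancel₀ (Complex.ofReal_ne_zero.2 (Real.exp_pos _).ne') h2

theorem cylLog_mul {z : ℂ} (hz : z ≠ 0) :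
    cylLog ((Real.exp (2 * Real.pi) : ℝ) * z) = cylLog z + (1, 0) := by
  obtain ⟨y, rfl⟩ : ∃ y, z = cylExp y := ⟨cylLog z, (cylExp_cylLog hz).symm⟩
  obtain ⟨x, θ⟩ := y
  rw [← cylExp_add_one, cylLog_cylExp, cylLog_cylExp, Prod.mk_add_mk, add_zero]

theorem continuousOn_cylLog : ContinuousOn cylLog {0}ᶜ := by
  intro z hz
  have hz : z ≠ 0 := hz
  have h1 : ContinuousAt (fun z : ℂ => Real.log ‖z‖ / (2 * Real.pi)) z :=
    (continuousAt_id.norm.log (norm_ne_zero_iff.2 hz)).div_const _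
  have h2 : ContinuousAt (fun z : ℂ => ((Complex.arg z / (2 * Real.pi) : ℝ) : AddCircle (1 : ℝ)))
      z := by
    have h3 := (AddCircle.homeomorphAddCircle (2 * Real.pi) 1 (by positivity)
      one_ne_zero).continuous.continuousAt.comp (Complex.continuousAt_arg_coe_angle hz)
    refine h3.congr (Eventually.of_forall fun w => ?_)
    change AddCircle.homeomorphAddCircle (2 * Real.pi) 1 _ _ ((Complex.arg w : ℝ) : AddCircle _) = _
    rw [AddCircle.homeomorphAddCircle_apply_mk, mul_one]
    simp only [div_eq_mul_inv]
  exact (h1.prodMk h2).continuousWithinAt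

/-- Data on the cylinder lifting a fiber bundle projection of the torus onto the circle whose
class is the first coordinate. -/
structure IsCylSlide (P : Cyl → ℝ) : Prop where
  continuous : Continuous P
  add_one : ∀ x θ, P (x + 1, θ) = P (x, θ) + 1
  slide : ∀ b : ℝ, ∃ a c, a < b ∧ b < c ∧ ∃ σ : ℝ → Cyl → Cyl,
    ContinuousOn (fun x : ℝ × Cyl => σ x.1 x.2) (Ioo a c ×ˢ (P ⁻¹' Ioo a c)) ∧
    ∀ t ∈ Ioo a c, ∀ z, P z ∈ Ioo a c → P (σ t z) = t ∧ σ (P z) z = z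

open scoped Classical in
/-- The function on the plane corresponding to a function on the cylinder. -/
noncomputable def planeFun (P : Cyl → ℝ) (z : ℂ) : ℝ :=
  if z = 0 then 0 else Real.exp (2 * Real.pi * P (cylLog z))

theorem planeFun_of_ne {P : Cyl → ℝ} {z : ℂ} (hz : z ≠ 0) :
    planeFun P z = Real.exp (2 * Real.pi * P (cylLog z)) := if_neg hz

theorem planeFun_cylExp (P : Cyl → ℝ) (y : Cyl) :
    planeFun P (cylExp y) = Real.exp (2 * Real.pi * P y) := by
  rw [planeFun_of_ne (cylExp_ne_zero y), cylLog_cylExp]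

theorem planeFun_zero (P : Cyl → ℝ) : planeFun P 0 = 0 := if_pos rfl

theorem exp_mul_mem_Ioo_iff {a c x : ℝ} : Real.exp (2 * Real.pi * x) ∈
    Ioo (Real.exp (2 * Real.pi * a)) (Real.exp (2 * Real.pi * c)) ↔ x ∈ Ioo a c := by
  simp only [mem_Ioo, Real.exp_lt_exp, mul_lt_mul_iff_right₀ Real.two_pi_pos]

theorem exists_eq_exp_mul {b : ℝ} (hb : 0 < b) : ∃ x, b = Real.exp (2 * Real.pi * x) :=
  ⟨Real.log b / (2 * Real.pi), by
    rw [mul_div_cancel₀ _ Real.two_pi_pos.ne', Real.exp_log hb]⟩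

theorem log_exp_mul_div (x : ℝ) : Real.log (Real.exp (2 * Real.pi * x)) / (2 * Real.pi) = x := by
  rw [Real.log_exp, mul_div_cancel_left₀ _ Real.two_pi_pos.ne']

theorem IsCylSlide.isSlideFunction {P : Cyl → ℝ} (hP : IsCylSlide P) :
    IsSlideFunction (Real.exp (2 * Real.pi)) (planeFun P) where
  one_lt := Real.one_lt_exp_iff.2 Real.two_pi_pos
  contOn := by
    have h1 : ContinuousOn (fun z => Real.exp (2 * Real.pi * P (cylLog z))) {0}ᶜ :=
      (continuousOn_const.mul (hP.continuous.comp_continuousOn continuousOn_cylLog)).rexp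
    exact h1.congr fun z hz => planeFun_of_ne hz
  zero := planeFun_zero P
  pos z hz := by rw [planeFun_of_ne hz]; exact Real.exp_pos _
  scale z := by
    rcases eq_or_ne z 0 with rfl | hz
    · simp [planeFun_zero]
    · rw [planeFun_of_ne hz, planeFun_of_ne
        (mul_ne_zero (Complex.ofReal_ne_zero.2 (Real.exp_pos _).ne') hz), cylLog_mul hz]
      generalize cylLog z = y
      obtain ⟨x, θ⟩ := y
      rw [Prod.mk_add_mk, add_zero, hP.add_one, mul_add, mul_one, Real.exp_add, mul_comm]
  slide b hb := by
    obtain ⟨b, rfl⟩ := exists_eq_exp_mul hb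
    obtain ⟨a, c, hab, hbc, σ, hσ, hs⟩ := hP.slide b
    have hne : ∀ z, planeFun P z ∈ Ioo (Real.exp (2 * Real.pi * a)) (Real.exp (2 * Real.pi * c)) →
        z ≠ 0 := by
      rintro z hz rfl
      rw [planeFun_zero] at hz
      exact (Real.exp_pos _).not_gt hz.1
    have hmem : ∀ z, planeFun P z ∈
        Ioo (Real.exp (2 * Real.pi * a)) (Real.exp (2 * Real.pi * c)) → P (cylLog z) ∈ Ioo a c := by
      intro z hz
      rwa [planeFun_of_ne (hne z hz), exp_mul_mem_Ioo_iff] at hz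
    refine ⟨Real.exp (2 * Real.pi * a), Real.exp (2 * Real.pi * c), Real.exp_pos _, Real.exp_lt_exp.2 (by gcongr),
      Real.exp_lt_exp.2 (by gcongr),
      fun t z => cylExp (σ (Real.log t / (2 * Real.pi)) (cylLog z)), ?_, ?_⟩
    · refine continuous_cylExp.comp_continuousOn (hσ.comp
        (f := fun x : ℝ × ℂ => (Real.log x.1 / (2 * Real.pi), cylLog x.2)) ?_ ?_)
      · refine ContinuousOn.prodMk ?_ ?_
        · refine (continuousOn_fst.log fun x hx => ?_).div_const _
          exact ((Real.exp_pos _).trans hx.1.1).ne'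
        · exact continuousOn_cylLog.comp continuousOn_snd fun x hx => hne _ hx.2
      · rintro ⟨t, z⟩ ⟨ht, hz⟩
        refine ⟨?_, hmem z hz⟩
        obtain ⟨t, rfl⟩ := exists_eq_exp_mul ((Real.exp_pos _).trans ht.1)
        simp only
        rw [log_exp_mul_div]
        exact exp_mul_mem_Ioo_iff.1 ht
    · intro t ht z hz
      obtain ⟨t, rfl⟩ := exists_eq_exp_mul ((Real.exp_pos _).trans ht.1)
      obtain ⟨h1, h2⟩ := hs t (exp_mul_mem_Ioo_iff.1 ht) _ (hmem z hz)
      simp only [log_exp_mul_div, planeFun_cylExp, h1, planeFun_of_ne (hne z hz), h2,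
        cylExp_cylLog (hne z hz), and_self]

/-- `G` is the first coordinate up to a homeomorphism of the cylinder commuting with the deck
transformation. -/
def IsStraightenable (G : Cyl → ℝ) : Prop :=
  ∃ Θ : Cyl → Cyl, Continuous Θ ∧ Function.Bijective Θ ∧ (∀ y, Θ (y + (1, 0)) = Θ y + (1, 0)) ∧
    ∀ y, G (Θ y) = y.1

theorem IsCylSlide.exists_deformation {P : Cyl → ℝ} (hP : IsCylSlide P) :
    ∃ G : ℝ → Cyl → ℝ, ContinuousOn (fun x : ℝ × Cyl => G x.1 x.2) (Icc 0 1 ×ˢ univ) ∧ G 1 = P ∧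
      (∀ r ∈ Icc (0 : ℝ) 1, ∀ x θ, G r (x + 1, θ) = G r (x, θ) + 1) ∧
      (∀ x x' θ θ', x < x' → G 0 (x, θ) < G 0 (x', θ')) ∧
      (∀ x θ θ', G 0 (x, θ) = G 0 (x, θ')) ∧ ∀ r ∈ Ico (0 : ℝ) 1, IsStraightenable (G r) := by
  obtain ⟨F, hF, hF1, hFs, hF0, hF0', hFΘ⟩ := hP.isSlideFunction.exists_interpolation
  have hpos : ∀ r ∈ Icc (0 : ℝ) 1, ∀ y, 0 < F r (cylExp y) := fun r hr y =>
    (hFs r hr _ (cylExp_ne_zero y)).1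
  refine ⟨fun r y => Real.log (F r (cylExp y)) / (2 * Real.pi), ?_, ?_, ?_, ?_, ?_, ?_⟩
  · refine (ContinuousOn.log ?_ fun x hx => (hpos x.1 hx.1 x.2).ne').div_const _
    exact hF.comp (f := fun x : ℝ × Cyl => (x.1, cylExp x.2))
      (continuous_fst.prodMk (continuous_cylExp.comp continuous_snd)).continuousOn
      fun x hx => ⟨hx.1, cylExp_ne_zero _⟩
  · ext y
    simp only
    rw [hF1 _ (cylExp_ne_zero y), planeFun_cylExp, log_exp_mul_div]
  · intro r hr x θ
    simp only
    rw [cylExp_add_one, (hFs r hr _ (cylExp_ne_zero _)).2,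
      Real.log_mul (Real.exp_pos _).ne' (hpos r hr _).ne', Real.log_exp, add_div,
      div_self Real.two_pi_pos.ne', add_comm]
  · intro x x' θ θ' hx
    refine div_lt_div_of_pos_right (Real.log_lt_log (hpos 0 ⟨le_rfl, zero_le_one⟩ _)
      (hF0 _ _ (cylExp_ne_zero _) ?_)) Real.two_pi_pos
    rw [norm_cylExp, norm_cylExp, Real.exp_lt_exp, mul_lt_mul_iff_right₀ Real.two_pi_pos]
    exact hx
  · intro x θ θ'
    simp only
    rw [hF0' (cylExp (x, θ)) (cylExp (x, θ'))]
    rw [norm_cylExp, norm_cylExp]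
  · intro r hr
    obtain ⟨Θ, hΘc, hΘ, hΘs⟩ := hFΘ r hr
    have hsph : ∀ θ, cylExp (0, θ) ∈ sphere (0 : ℂ) 1 := fun θ => by
      rw [mem_sphere_zero_iff_norm, norm_cylExp, mul_zero, Real.exp_zero]
    have hE : ∀ x, 0 < Real.exp (2 * Real.pi * x) := fun x => Real.exp_pos _
    refine ⟨fun y => cylLog (Θ (Real.exp (2 * Real.pi * y.1)) (cylExp (0, y.2))), ?_, ⟨?_, ?_⟩,
      ?_, ?_⟩
    · refine continuousOn_cylLog.comp_continuous (hΘc.comp_continuous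
        (f := fun y : Cyl => (Real.exp (2 * Real.pi * y.1), cylExp (0, y.2))) ?_ ?_) ?_
      · exact Continuous.prodMk (by fun_prop)
          (continuous_cylExp.comp (continuous_const.prodMk continuous_snd))
      · exact fun y => ⟨hE _, hsph _⟩
      · exact fun y => (hΘ _ (hE _) _ (hsph _)).1
    · rintro ⟨x, θ⟩ ⟨x', θ'⟩ hyy
      have h1 := congrArg cylExp hyy
      simp only at h1
      rw [cylExp_cylLog (hΘ _ (hE _) _ (hsph _)).1, cylExp_cylLog (hΘ _ (hE _) _ (hsph _)).1] at h1
      have h2 := congrArg (F r) h1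
      rw [(hΘ _ (hE _) _ (hsph _)).2.1, (hΘ _ (hE _) _ (hsph _)).2.1] at h2
      rw [← h2] at h1
      have h3 := (hΘ _ (hE _) _ (hsph _)).2.2.2 _ (hsph _) h1
      have h4 := congrArg cylLog h3
      rw [cylLog_cylExp, cylLog_cylExp] at h4
      have h5 : x = x' := mul_left_cancel₀ Real.two_pi_pos.ne' (Real.exp_injective h2)
      rw [h5, show θ = θ' from congrArg Prod.snd h4]
    · intro y
      obtain ⟨w, hw, hwy⟩ := hΘs _ (cylExp_ne_zero y)
      obtain ⟨x, hx⟩ := exists_eq_exp_mul (hpos r ⟨hr.1, hr.2.le⟩ y)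
      have hw1 := mem_sphere_zero_iff_norm.1 hw
      have hw0 : w ≠ 0 := norm_ne_zero_iff.1 (hw1 ▸ one_ne_zero)
      have h1 : cylExp (0, (cylLog w).2) = w := by
        have h2 : (cylLog w).1 = 0 := by simp [cylLog, hw1]
        rw [← h2]
        exact cylExp_cylLog hw0
      refine ⟨(x, (cylLog w).2), ?_⟩
      simp only
      rw [h1, ← hx, hwy, cylLog_cylExp]
    · rintro ⟨x, θ⟩
      have h1 := hΘ _ (hE x) _ (hsph θ)
      rw [Prod.mk_add_mk, add_zero]
      simp only
      rw [mul_add, mul_one, Real.exp_add, mul_comm, h1.2.2.1, cylLog_mul h1.1]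
    · rintro ⟨x, θ⟩
      have h1 := hΘ _ (hE x) _ (hsph θ)
      simp only
      rw [cylExp_cylLog h1.1, h1.2.1, log_exp_mul_div]

/-- The circle. -/
abbrev Circ : Type := AddCircle (1 : ℝ)

/-- The torus. -/
abbrev Tor : Type := Circ × Circ

/-- The covering of the torus by the cylinder. -/
noncomputable def cylCover (y : Cyl) : Tor := ((y.1 : Circ), y.2)

theorem isOpenQuotientMap_coe : IsOpenQuotientMap ((↑) : ℝ → Circ) :=
  QuotientAddGroup.isOpenQuotientMap_mk

theorem isOpenQuotientMap_cylCover : IsOpenQuotientMap cylCover :=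
  isOpenQuotientMap_coe.prodMap .id

theorem coe_eq_coe_iff {x y : ℝ} : (x : Circ) = y ↔ ∃ n : ℤ, y = x + n := by
  rw [eq_comm, ← sub_eq_zero, ← AddCircle.coe_sub, AddCircle.coe_eq_zero_iff]
  refine exists_congr fun n => ?_
  rw [zsmul_eq_mul, mul_one, eq_sub_iff_add_eq, eq_comm, add_comm]

theorem cylCover_eq_iff {y y' : Cyl} : cylCover y = cylCover y' ↔ ∃ n : ℤ, y' = y + ((n : ℝ), 0) := by
  obtain ⟨x, θ⟩ := y
  obtain ⟨x', θ'⟩ := y'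
  simp only [cylCover, Prod.mk_add_mk, add_zero, Prod.mk.injEq, coe_eq_coe_iff]
  exact ⟨fun ⟨⟨n, hn⟩, hθ⟩ => ⟨n, hn, hθ.symm⟩, fun ⟨n, hn, hθ⟩ => ⟨⟨n, hn⟩, hθ.symm⟩⟩

theorem apply_add_zsmul {X A : Type*} [AddCommGroup X] [AddCommGroup A] {G : X → A} {e : X} {c : A}
    (h : ∀ y, G (y + e) = G y + c) (y : X) (n : ℤ) : G (y + n • e) = G y + n • c := by
  induction n with
  | zero => simp
  | succ n ih => rw [add_smul, one_smul, ← add_assoc, h, ih, add_smul, one_smul, add_assoc]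
  | pred n ih =>
    have h1 := h (y + (-(n : ℤ) - 1) • e)
    rw [add_assoc, ← add_one_zsmul, sub_add_cancel, ih] at h1
    rw [eq_sub_of_add_eq h1.symm, sub_smul, one_smul, add_sub_assoc]

theorem apply_add_int {A : Type*} [AddCommGroup A] {G : Cyl → A} {c : A}
    (h : ∀ y, G (y + (1, 0)) = G y + c) (y : Cyl) (n : ℤ) :
    G (y + ((n : ℝ), 0)) = G y + n • c := by
  have := apply_add_zsmul h y n
  rwa [Prod.smul_mk, smul_zero, zsmul_one] at this

theorem isFiberBundleProj_of_homeomorph {g : Tor → Circ} (A : Tor ≃ₜ Tor) (h : ∀ v, g (A v) = v.1) :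
    IsFiberBundleProj Circ g := by
  intro b
  refine ⟨univ, isOpen_univ, mem_univ b, (Homeomorph.Set.univ Tor).trans (A.symm.trans
    ((Homeomorph.Set.univ Circ).symm.prodCongr (Homeomorph.refl Circ))), fun z => ?_⟩
  have := h (A.symm z)
  rw [A.apply_symm_apply] at this
  exact this.symm

theorem IsFiberBundleProj.comp_homeomorph {E E' B F : Type*} [TopologicalSpace E]
    [TopologicalSpace E'] [TopologicalSpace B] [TopologicalSpace F] {p : E → B}
    (hp : IsFiberBundleProj F p) (A : E' ≃ₜ E) : IsFiberBundleProj F (fun z => p (A z)) := by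
  intro b
  obtain ⟨U, hU, hb, e, he⟩ := hp b
  exact ⟨U, hU, hb, (A.sets (t := p ⁻¹' U) rfl).trans e, fun z => he _⟩

theorem IsStraightenable.isFiberBundleProj {G : Cyl → ℝ} (hG : IsStraightenable G) {g : Tor → Circ}
    (h : ∀ y, g (cylCover y) = G y) : IsFiberBundleProj Circ g := by
  obtain ⟨Θ, hΘc, hΘ, hΘs, hGΘ⟩ := hG
  let cov : C(Cyl, Tor) := ⟨cylCover, isOpenQuotientMap_cylCover.continuous⟩
  have hq : IsQuotientMap cov := isOpenQuotientMap_cylCover.isQuotientMap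
  have hper := apply_add_int (G := Θ) hΘs
  have hsmul : ∀ n : ℤ, n • ((1 : ℝ), (0 : Circ)) = ((n : ℝ), 0) := fun n => by simp
  have hfac : Function.FactorsThrough (cov.comp ⟨Θ, hΘc⟩) cov := by
    intro y y' hyy
    obtain ⟨n, rfl⟩ := cylCover_eq_iff.1 hyy
    refine cylCover_eq_iff.2 ⟨n, ?_⟩
    simp only [ContinuousMap.coe_mk]
    rw [hper, hsmul]
  let A : C(Tor, Tor) := hq.lift _ hfac
  have hA : ∀ y, A (cylCover y) = cylCover (Θ y) := fun y =>
    DFunLike.congr_fun (hq.lift_comp _ hfac) y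
  have hsurj := isOpenQuotientMap_cylCover.surjective
  have hbij : Function.Bijective A := by
    constructor
    · intro v v' hvv
      obtain ⟨y, rfl⟩ := hsurj v
      obtain ⟨y', rfl⟩ := hsurj v'
      rw [hA, hA] at hvv
      obtain ⟨n, hn⟩ := cylCover_eq_iff.1 hvv
      rw [← hsmul, ← hper] at hn
      exact cylCover_eq_iff.2 ⟨n, hΘ.1 hn⟩
    · intro v
      obtain ⟨y, rfl⟩ := hsurj v
      obtain ⟨y, rfl⟩ := hΘ.2 y
      exact ⟨_, hA y⟩
  refine isFiberBundleProj_of_homeomorph (Continuous.homeoOfEquivCompactToT2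
    (f := Equiv.ofBijective A hbij) A.continuous) fun v => ?_
  obtain ⟨y, rfl⟩ := hsurj v
  change g (A (cylCover y)) = _
  rw [hA, h, hGΘ]
  rfl

/-- Homotopy through fiber bundle projections. -/
abbrev BundleHomotopic (f g : C(Tor, Circ)) : Prop :=
  ContinuousMap.HomotopicWith f g fun k => IsFiberBundleProj Circ k

theorem bundleHomotopic_of_lift {G : ℝ → Cyl → ℝ}
    (hc : ContinuousOn (fun x : ℝ × Cyl => G x.1 x.2) (Icc 0 1 ×ˢ univ))
    (hs : ∀ r ∈ Icc (0 : ℝ) 1, ∀ x θ, G r (x + 1, θ) = G r (x, θ) + 1) {f g : C(Tor, Circ)}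
    (hf : ∀ y, f (cylCover y) = G 0 y) (hg : ∀ y, g (cylCover y) = G 1 y)
    (hb : ∀ r ∈ Icc (0 : ℝ) 1, ∀ k : Tor → Circ, (∀ y, k (cylCover y) = G r y) →
      IsFiberBundleProj Circ k) : BundleHomotopic f g := by
  have hqq := (IsOpenQuotientMap.id (X := unitInterval)).prodMap isOpenQuotientMap_cylCover
  let cov : C(unitInterval × Cyl, unitInterval × Tor) := ⟨Prod.map id cylCover, hqq.continuous⟩
  have hq : IsQuotientMap cov := hqq.isQuotientMap
  have hGc : Continuous fun x : unitInterval × Cyl => ((G x.1 x.2 : ℝ) : Circ) :=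
    isOpenQuotientMap_coe.continuous.comp (hc.comp_continuous
      (f := fun x : unitInterval × Cyl => ((x.1 : ℝ), x.2)) (by fun_prop) fun x => ⟨x.1.2, trivial⟩)
  have hfac : Function.FactorsThrough (⟨_, hGc⟩ : C(unitInterval × Cyl, Circ)) cov := by
    rintro ⟨r, y⟩ ⟨r', y'⟩ hyy
    obtain ⟨rfl, h2⟩ := Prod.mk.injEq .. ▸ (show (r, cylCover y) = (r', cylCover y') from hyy)
    obtain ⟨n, rfl⟩ := cylCover_eq_iff.1 h2
    refine coe_eq_coe_iff.2 ⟨n, ?_⟩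
    simp only
    rw [apply_add_int (G := G r) (c := 1) (fun y => by
      obtain ⟨x, θ⟩ := y
      rw [Prod.mk_add_mk, add_zero, hs r r.2]), zsmul_eq_mul, mul_one]
  let H : C(unitInterval × Tor, Circ) := hq.lift _ hfac
  have hH : ∀ r y, H (r, cylCover y) = G r y := fun r y =>
    DFunLike.congr_fun (hq.lift_comp _ hfac) (r, y)
  have hsurj := isOpenQuotientMap_cylCover.surjective
  refine ⟨⟨⟨H, fun v => ?_, fun v => ?_⟩, fun t => ?_⟩⟩
  · obtain ⟨y, rfl⟩ := hsurj v
    exact (hH 0 y).trans (hf y).symm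
  · obtain ⟨y, rfl⟩ := hsurj v
    exact (hH 1 y).trans (hg y).symm
  · exact hb t t.2 _ fun y => hH t y

theorem isStraightenable_of_strictMono {M : ℝ → ℝ} (hc : Continuous M) (hm : StrictMono M)
    (hs : ∀ x, M (x + 1) = M x + 1) : IsStraightenable fun y => M y.1 := by
  have hper : ∀ n : ℤ, M n = M 0 + n := fun n => by
    have := apply_add_int (G := fun y : Cyl => M y.1) (c := 1) (fun y => hs y.1) 0 n
    simpa using this
  have hsurj : Function.Surjective M := by
    intro t
    obtain ⟨n, hn⟩ := exists_int_lt (t - M 0)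
    obtain ⟨k, hk⟩ := exists_int_gt (t - M 0)
    obtain ⟨x, -, hx⟩ := intermediate_value_Icc (a := (n : ℝ)) (b := k) (hn.trans hk).le
      hc.continuousOn (show t ∈ Icc (M n) (M k) by
        rw [hper, hper]; constructor <;> linarith)
    exact ⟨x, hx⟩
  let e : ℝ ≃o ℝ := hm.orderIsoOfSurjective M hsurj
  have he : ∀ x, M (e.symm x) = x := e.apply_symm_apply
  refine ⟨fun y => (e.symm y.1, y.2), ?_, ⟨?_, ?_⟩, ?_, fun y => he y.1⟩
  · exact (e.symm.continuous.comp continuous_fst).prodMk continuous_snd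
  · rintro ⟨x, θ⟩ ⟨x', θ'⟩ hxx
    simpa using hxx
  · rintro ⟨x, θ⟩
    exact ⟨(e x, θ), by simp⟩
  · rintro ⟨x, θ⟩
    refine Prod.ext (hm.injective ?_) rfl
    simp only [Prod.mk_add_mk, add_zero]
    rw [he, hs, he]

theorem IsCylSlide.bundleHomotopic_fst {P : Cyl → ℝ} (hP : IsCylSlide P) {p : C(Tor, Circ)}
    (hp : IsFiberBundleProj Circ p) (hpP : ∀ y, p (cylCover y) = P y) :
    BundleHomotopic ContinuousMap.fst p := by
  obtain ⟨G, hGc, hG1, hGs, hG0, hG0', hGΘ⟩ := hP.exists_deformation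
  have h0 : (0 : ℝ) ∈ Icc (0 : ℝ) 1 := ⟨le_rfl, zero_le_one⟩
  have hsurj := isOpenQuotientMap_cylCover.surjective
  set L : ℝ → ℝ := fun x => G 0 (x, 0) with hL
  have hLc : Continuous L := hGc.comp_continuous
    (f := fun x : ℝ => ((0 : ℝ), ((x, 0) : Cyl))) (by fun_prop) fun x => ⟨h0, trivial⟩
  have hLm : StrictMono L := fun x x' hx => hG0 _ _ _ _ hx
  have hLs : ∀ x, L (x + 1) = L x + 1 := fun x => hGs 0 h0 x 0
  let cov : C(ℝ, Circ) := ⟨_, isOpenQuotientMap_coe.continuous⟩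
  have hq : IsQuotientMap cov := isOpenQuotientMap_coe.isQuotientMap
  have hfac : Function.FactorsThrough (cov.comp ⟨L, hLc⟩) cov := by
    intro x x' hxx
    obtain ⟨n, rfl⟩ := coe_eq_coe_iff.1 hxx
    refine coe_eq_coe_iff.2 ⟨n, ?_⟩
    have := apply_add_int (G := fun y : Cyl => L y.1) (c := 1) (fun y => hLs y.1) (x, 0) n
    simpa using this
  let l : C(Circ, Circ) := hq.lift _ hfac
  have hl : ∀ x : ℝ, l x = L x := fun x => DFunLike.congr_fun (hq.lift_comp _ hfac) x
  have hl' : ∀ y, (l.comp ContinuousMap.fst) (cylCover y) = G 0 y := by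
    rintro ⟨x, θ⟩
    exact (hl x).trans (congrArg _ (hG0' x 0 θ))
  have h1 : BundleHomotopic (l.comp ContinuousMap.fst) p := by
    refine bundleHomotopic_of_lift hGc hGs hl' (fun y => by rw [hpP, hG1]) ?_
    intro r hr k hk
    rcases hr.2.lt_or_eq with hr1 | rfl
    · exact (hGΘ r ⟨hr.1, hr1⟩).isFiberBundleProj hk
    · have : k = p := by
        ext v
        obtain ⟨y, rfl⟩ := hsurj v
        rw [hk, hpP, hG1]
      rwa [this]
  have h2 : BundleHomotopic ContinuousMap.fst (l.comp ContinuousMap.fst) := by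
    refine bundleHomotopic_of_lift (G := fun r y => (1 - r) * y.1 + r * L y.1) ?_ ?_ ?_ ?_ ?_
    · have : Continuous fun x : ℝ × Cyl => (1 - x.1) * x.2.1 + x.1 * L x.2.1 := by fun_prop
      exact this.continuousOn
    · intro r _ x θ
      simp only
      rw [hLs]; ring
    · intro y
      simp [cylCover]
    · intro y
      simp only [sub_self, zero_mul, zero_add, one_mul]
      exact hl y.1
    · intro r hr k hk
      refine (isStraightenable_of_strictMono (M := fun x => (1 - r) * x + r * L x)
        (by fun_prop) ?_ fun x => ?_).isFiberBundleProj hk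
      · intro x x' hx
        have h3 := hLm hx
        rcases hr.1.lt_or_eq with h4 | rfl
        · have := mul_lt_mul_of_pos_left h3 h4
          have := mul_le_mul_of_nonneg_left hx.le (sub_nonneg.2 hr.2)
          simp only
          linarith
        · simpa using hx
      · rw [hLs]; ring
  exact h2.trans h1

theorem IsFiberBundleProj.exists_trivialization {p : Tor → Circ} (hp : IsFiberBundleProj Circ p)
    (b : Circ) : ∃ U, IsOpen U ∧ b ∈ U ∧ ∃ (E : Tor → Circ) (D : Circ × Circ → Tor),
      ContinuousOn E (p ⁻¹' U) ∧ ContinuousOn D (U ×ˢ univ) ∧ (∀ v, p v ∈ U → D (p v, E v) = v) ∧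
      ∀ u ∈ U, ∀ w, p (D (u, w)) = u ∧ E (D (u, w)) = w := by
  classical
  obtain ⟨U, hU, hb, e, he⟩ := hp b
  refine ⟨U, hU, hb, fun v => if h : p v ∈ U then (e ⟨v, h⟩).2 else 0,
    fun x => if h : x.1 ∈ U then (e.symm (⟨x.1, h⟩, x.2) : p ⁻¹' U) else 0, ?_, ?_, ?_, ?_⟩
  · rw [continuousOn_iff_continuous_domRestrict]
    have : Continuous fun v : p ⁻¹' U => (e v).2 := by fun_prop
    refine this.congr fun v => ?_
    rw [domRestrict_apply, dif_pos (show p v ∈ U from v.2)]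
  · rw [continuousOn_iff_continuous_domRestrict]
    have : Continuous fun x : (U ×ˢ univ : Set (Circ × Circ)) =>
        ((e.symm (⟨x.1.1, x.2.1⟩, x.1.2) : p ⁻¹' U) : Tor) := by fun_prop
    refine this.congr fun x => ?_
    rw [domRestrict_apply, dif_pos (show x.1.1 ∈ U from x.2.1)]
  · intro v hv
    simp only [dif_pos hv]
    have h1 : (⟨p v, hv⟩ : U) = (e ⟨v, hv⟩).1 := Subtype.ext (he ⟨v, hv⟩).symm
    rw [h1, Prod.mk.eta, e.symm_apply_apply]
  · intro u hu w
    simp only [dif_pos hu]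
    have h1 := he (e.symm (⟨u, hu⟩, w))
    rw [e.apply_symm_apply] at h1
    have h2 : p (e.symm (⟨u, hu⟩, w) : p ⁻¹' U) = u := h1.symm
    refine ⟨h2, ?_⟩
    rw [dif_pos (h2.symm ▸ hu)]
    exact congrArg Prod.snd (e.apply_symm_apply (⟨u, hu⟩, w))

theorem exists_section_cylCover {W : Set Cyl} (hW : IsOpen W) (hinj : InjOn cylCover W) :
    ∃ s : Tor → Cyl, ContinuousOn s (cylCover '' W) ∧ ∀ y ∈ W, s (cylCover y) = y := by
  let e := OpenPartialHomeomorph.ofContinuousOpen (hinj.toPartialEquiv cylCover W)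
    isOpenQuotientMap_cylCover.continuous.continuousOn isOpenQuotientMap_cylCover.isOpenMap hW
  exact ⟨e.symm, e.continuousOn_symm, fun y hy => e.left_inv hy⟩

theorem isCylSlide_of_lift {p : C(Tor, Circ)} (hp : IsFiberBundleProj Circ p) {P : Cyl → ℝ}
    (hc : Continuous P) (hpP : ∀ y, p (cylCover y) = P y)
    (hs : ∀ y, P (y + (1, 0)) = P y + 1) : IsCylSlide P where
  continuous := hc
  add_one x θ := by simpa using hs (x, θ)
  slide b := by
    obtain ⟨U, hU, hb, E, D, hE, hD, hDE, hpD⟩ := IsFiberBundleProj.exists_trivialization hp b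
    have hcoe := isOpenQuotientMap_coe.continuous
    obtain ⟨ε, hε, hεU⟩ := Metric.isOpen_iff.1 (hU.preimage hcoe) b hb
    set δ := min ε (1 / 2) with hδ
    have hδ0 : 0 < δ := lt_min hε (by norm_num)
    have hδ1 : δ ≤ 1 / 2 := min_le_right _ _
    have hIU : ∀ t ∈ Ioo (b - δ) (b + δ), (t : Circ) ∈ U := fun t ht => hεU (by
      rw [Real.ball_eq_Ioo]
      exact Ioo_subset_Ioo (by linarith [min_le_left ε (1 / 2)])
        (by linarith [min_le_left ε (1 / 2)]) ht)
    have hper := apply_add_int hs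
    obtain ⟨s, hsc, hs'⟩ := exists_section_cylCover
      (W := P ⁻¹' Ioo (b - δ) (b + δ)) (isOpen_Ioo.preimage hc) (by
      intro y hy y' hy' hyy
      obtain ⟨n, rfl⟩ := cylCover_eq_iff.1 hyy
      rw [mem_preimage, hper, zsmul_eq_mul, mul_one] at hy'
      have h1 : (n : ℝ) < 1 := by linarith [hy.1, hy'.2]
      have h2 : (-1 : ℝ) < n := by linarith [hy.2, hy'.1]
      have h3 : n = 0 := by
        have : n < 1 := by exact_mod_cast h1
        have : -1 < n := by exact_mod_cast h2
        omega
      simp [h3, ← Prod.zero_eq_mk])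
    have hex : ∀ t ∈ Ioo (b - δ) (b + δ), ∀ v, p v = t → ∃ y, P y = t ∧ cylCover y = v := by
      intro t ht v hv
      obtain ⟨y, rfl⟩ := isOpenQuotientMap_cylCover.surjective v
      rw [hpP] at hv
      obtain ⟨n, hn⟩ := coe_eq_coe_iff.1 hv
      exact ⟨y + ((n : ℝ), 0), by rw [hper, hn, zsmul_eq_mul, mul_one],
        (cylCover_eq_iff.2 ⟨n, rfl⟩).symm⟩
    refine ⟨b - δ, b + δ, by linarith, by linarith, fun t z => s (D (t, E (cylCover z))), ?_, ?_⟩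
    · refine hsc.comp (hD.comp (f := fun x : ℝ × Cyl => ((x.1 : Circ), E (cylCover x.2))) ?_ ?_) ?_
      · refine (hcoe.comp continuous_fst).continuousOn.prodMk (hE.comp
          (isOpenQuotientMap_cylCover.continuous.comp continuous_snd).continuousOn ?_)
        intro x hx
        rw [mem_preimage]
        simp only
        rw [hpP]
        exact hIU _ hx.2
      · exact fun x hx => ⟨hIU _ hx.1, trivial⟩
      · intro x hx
        obtain ⟨y, hy, hy'⟩ := hex x.1 hx.1 _ (hpD _ (hIU _ hx.1) (E (cylCover x.2))).1
        exact ⟨y, by rw [mem_preimage, hy]; exact hx.1, hy'⟩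
    · intro t ht z hz
      simp only
      constructor
      · obtain ⟨y, hy, hy'⟩ := hex t ht _ (hpD _ (hIU _ ht) (E (cylCover z))).1
        rw [← hy', hs' y (by rw [mem_preimage, hy]; exact ht), hy]
      · rw [← hpP, hDE _ (by rw [hpP]; exact hIU _ hz), hs' z hz]

theorem exists_apply_eq_of_period {P : Cyl → ℝ} (hc : Continuous P) {d : ℝ} (hd : 0 < d)
    (hs : ∀ y, P (y + (1, 0)) = P y + d) (t : ℝ) : ∃ y, P y = t := by
  have hper : ∀ n : ℤ, P ((n : ℝ), 0) = P 0 + n * d := fun n => by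
    have := apply_add_int hs 0 n
    rwa [zero_add, zsmul_eq_mul] at this
  obtain ⟨n, hn⟩ := exists_int_lt ((t - P 0) / d)
  obtain ⟨k, hk⟩ := exists_int_gt ((t - P 0) / d)
  obtain ⟨x, -, hx⟩ := intermediate_value_Icc (a := (n : ℝ)) (b := k) (hn.trans hk).le
    (f := fun x => P (x, 0)) (by fun_prop) (show t ∈ Icc (P ((n : ℝ), 0)) (P ((k : ℝ), 0)) by
      rw [lt_div_iff₀ hd] at hn
      rw [div_lt_iff₀ hd] at hk
      rw [hper, hper]; constructor <;> linarith)
  exact ⟨_, hx⟩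

theorem period_ne_zero {p : C(Tor, Circ)} (hp : IsFiberBundleProj Circ p) {P : Cyl → ℝ}
    (hc : Continuous P) (hpP : ∀ y, p (cylCover y) = P y) : ¬ ∀ y, P (y + (1, 0)) = P y := by
  intro hs
  have hq : IsQuotientMap (⟨cylCover, isOpenQuotientMap_cylCover.continuous⟩ : C(Cyl, Tor)) :=
    isOpenQuotientMap_cylCover.isQuotientMap
  have hfac : Function.FactorsThrough (⟨P, hc⟩ : C(Cyl, ℝ))
      (⟨cylCover, isOpenQuotientMap_cylCover.continuous⟩ : C(Cyl, Tor)) := by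
    intro y y' hyy
    obtain ⟨n, rfl⟩ := cylCover_eq_iff.1 hyy
    have := apply_add_int (G := P) (c := 0) (fun y => by rw [hs, add_zero]) y n
    rw [smul_zero, add_zero] at this
    exact this.symm
  let f : C(Tor, ℝ) := hq.lift _ hfac
  have hf : ∀ y, f (cylCover y) = P y := fun y => DFunLike.congr_fun (hq.lift_comp _ hfac) y
  have hpf : ∀ v, p v = f v := fun v => by
    obtain ⟨y, rfl⟩ := isOpenQuotientMap_cylCover.surjective v
    rw [hpP, hf]
  obtain ⟨v, -, hv⟩ := isCompact_univ.exists_isMaxOn univ_nonempty f.continuous.continuousOn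
  obtain ⟨U, hU, hb, E, D, hE, hD, hDE, hpD⟩ := IsFiberBundleProj.exists_trivialization hp (p v)
  have hcoe := isOpenQuotientMap_coe.continuous
  have h1 : ContinuousAt (fun t : ℝ => f (D (t, E v))) (f v) := by
    have h2 : ContinuousAt D (((f v : ℝ) : Circ), E v) := by
      rw [← hpf]
      exact hD.continuousAt ((hU.prod isOpen_univ).mem_nhds ⟨hb, trivial⟩)
    exact f.continuous.continuousAt.comp (ContinuousAt.comp (f := fun t : ℝ => ((t : Circ), E v)) h2
      (by fun_prop))
  have h3 : f v - 1 / 2 < f (D (((f v : ℝ) : Circ), E v)) := by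
    rw [← hpf, hDE v hb]; linarith
  have h4 : ∀ᶠ t : ℝ in 𝓝 (f v), (t : Circ) ∈ U :=
    hcoe.continuousAt.eventually (hU.mem_nhds (by rw [← hpf]; exact hb))
  obtain ⟨t, ⟨⟨h5, h6⟩, h7⟩, h8⟩ := ((((h1.eventually (lt_mem_nhds h3)).and h4).and
    (gt_mem_nhds (show f v < f v + 1 / 2 by linarith))).filter_mono
      nhdsWithin_le_nhds |>.and (self_mem_nhdsWithin : Ioi (f v) ∈ 𝓝[>] f v)).exists
  have h9 := (hpD _ h6 (E v)).1
  rw [hpf] at h9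
  obtain ⟨n, hn⟩ := coe_eq_coe_iff.1 h9
  have h10 : f (D (t, E v)) ≤ f v := hv (mem_univ _)
  have h11 : f v < t := h8
  have h12 : (0 : ℝ) < n := by linarith
  have h13 : (n : ℝ) < 1 := by linarith
  have h14 : 0 < n := by exact_mod_cast h12
  have h15 : n < 1 := by exact_mod_cast h13
  omega

theorem period_eq_one {p : C(Tor, Circ)} (hp : IsFiberBundleProj Circ p) {P : Cyl → ℝ}
    (hc : Continuous P) (hpP : ∀ y, p (cylCover y) = P y) {d : ℕ}
    (hs : ∀ y, P (y + (1, 0)) = P y + d) : d = 1 := by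
  rcases Nat.eq_zero_or_pos d with rfl | hd
  · exact absurd (fun y => by simpa using hs y) (period_ne_zero hp hc hpP)
  have hd' : (0 : ℝ) < d := by exact_mod_cast hd
  have hcoe := isOpenQuotientMap_coe.continuous
  let cov : C(Cyl, Tor) := ⟨cylCover, isOpenQuotientMap_cylCover.continuous⟩
  have hq : IsQuotientMap cov := isOpenQuotientMap_cylCover.isQuotientMap
  have hfac : Function.FactorsThrough
      (⟨fun y => ((P y / d : ℝ) : Circ), by fun_prop⟩ : C(Cyl, Circ)) cov := by
    intro y y' hyy
    obtain ⟨n, rfl⟩ := cylCover_eq_iff.1 hyy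
    refine coe_eq_coe_iff.2 ⟨n, ?_⟩
    rw [apply_add_int hs, zsmul_eq_mul]
    field_simp
  let f : C(Tor, Circ) := hq.lift _ hfac
  have hf : ∀ y, f (cylCover y) = ((P y / d : ℝ) : Circ) := fun y =>
    DFunLike.congr_fun (hq.lift_comp _ hfac) y
  have hpf : ∀ v, d • f v = p v := fun v => by
    obtain ⟨y, rfl⟩ := isOpenQuotientMap_cylCover.surjective v
    rw [hpP, hf, ← AddCircle.coe_nsmul, nsmul_eq_mul, mul_div_cancel₀ _ hd'.ne']
  obtain ⟨U, hU, hb, E, D, hE, hD, hDE, hpD⟩ := IsFiberBundleProj.exists_trivialization hp 0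
  have hpre : IsPreconnected (range fun w => f (D (0, w))) :=
    isPreconnected_range (f.continuous.comp (hD.comp_continuous
      (f := fun w : Circ => ((0 : Circ), w)) (by fun_prop) fun w => ⟨hb, trivial⟩))
  have hsub : (range fun w => f (D (0, w))) ⊆ {u | d • u = 0} := by
    rintro _ ⟨w, rfl⟩
    rw [mem_ofPred_eq, hpf, (hpD 0 hb w).1]
  have hss := (AddCircle.finite_torsion (1 : ℝ) hd).countable.isTotallyDisconnected _ hsub hpre
  have hmem : ∀ y, p (cylCover y) = 0 → f (cylCover y) ∈ range fun w => f (D (0, w)) := by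
    intro y hy
    refine ⟨E (cylCover y), ?_⟩
    have := hDE (cylCover y) (hy ▸ hb)
    rw [hy] at this
    simp only [this]
  obtain ⟨y₀, h0⟩ := exists_apply_eq_of_period hc hd' hs 0
  obtain ⟨y₁, h1⟩ := exists_apply_eq_of_period hc hd' hs 1
  have h2 := hss (hmem y₀ (by rw [hpP, h0, AddCircle.coe_zero]))
    (hmem y₁ (by rw [hpP, h1]; exact AddCircle.coe_period 1))
  rw [hf, hf, h0, h1] at h2
  obtain ⟨n, hn⟩ := coe_eq_coe_iff.1 h2
  rw [zero_div, zero_add, div_eq_iff hd'.ne'] at hn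
  have h3 : (1 : ℤ) = n * d := by exact_mod_cast hn
  have h4 := Int.eq_one_or_neg_one_of_mul_eq_one' h3.symm
  omega

/-- The universal covering of the torus by the plane. -/
noncomputable def planeCover (z : ℝ × ℝ) : Tor := ((z.1 : Circ), (z.2 : Circ))

theorem continuous_planeCover : Continuous planeCover :=
  (isOpenQuotientMap_coe.prodMap isOpenQuotientMap_coe).continuous

theorem planeCover_add_int (z : ℝ × ℝ) (m n : ℤ) :
    planeCover (z + ((m : ℝ), (n : ℝ))) = planeCover z :=
  Prod.ext (coe_eq_coe_iff.2 ⟨m, rfl⟩).symm (coe_eq_coe_iff.2 ⟨n, rfl⟩).symm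

/-- The map `p` from the torus to the circle has a lift to the plane with periods `a` and `b`. -/
def HasPeriods (p : Tor → Circ) (a b : ℤ) : Prop :=
  ∃ P : ℝ × ℝ → ℝ, Continuous P ∧ (∀ z, p (planeCover z) = P z) ∧
    (∀ z, P (z + (1, 0)) = P z + a) ∧ ∀ z, P (z + (0, 1)) = P z + b

theorem exists_int_sub_eq {X : Type*} [TopologicalSpace X] [PreconnectedSpace X] [Nonempty X]
    {f g : X → ℝ} (hf : Continuous f) (hg : Continuous g) (h : ∀ x, (f x : Circ) = g x) :
    ∃ n : ℤ, ∀ x, g x = f x + n := by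
  have hsub : (range fun x => g x - f x) ⊆ range ((↑) : ℤ → ℝ) := by
    rintro _ ⟨x, rfl⟩
    obtain ⟨n, hn⟩ := coe_eq_coe_iff.1 (h x)
    exact ⟨n, by simp [hn]⟩
  have hss := (countable_range ((↑) : ℤ → ℝ)).isTotallyDisconnected _ hsub
    (isPreconnected_range (hg.sub hf))
  obtain ⟨x₀⟩ := ‹Nonempty X›
  obtain ⟨n, hn⟩ := hsub (mem_range_self x₀)
  refine ⟨n, fun x => ?_⟩
  have := hss (mem_range_self x) (mem_range_self x₀)
  rw [← hn, sub_eq_iff_eq_add'] at this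
  exact this

theorem exists_hasPeriods_of_homotopic {p q : C(Tor, Circ)} (h : p.Homotopic q) :
    ∃ a b : ℤ, HasPeriods p a b ∧ HasPeriods q a b := by
  obtain ⟨H⟩ := h
  let f : C(ℝ × (ℝ × ℝ), Circ) :=
    ⟨fun x => H (projIcc 0 1 zero_le_one x.1, planeCover x.2),
      H.continuous.comp ((continuous_projIcc.comp continuous_fst).prodMk
        (continuous_planeCover.comp continuous_snd))⟩
  obtain ⟨e₀, he₀⟩ := isOpenQuotientMap_coe.surjective (f 0)
  obtain ⟨F, ⟨-, hF⟩, -⟩ := (AddCircle.isCoveringMap_coe (1 : ℝ)).existsUnique_continuousMap_lifts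
    f 0 e₀ he₀
  have hF' : ∀ t z, ((F (t, z) : ℝ) : Circ) = H (projIcc 0 1 zero_le_one t, planeCover z) :=
    fun t z => congrFun hF (t, z)
  have key : ∀ m n : ℤ, ∃ a : ℤ, ∀ x : ℝ × (ℝ × ℝ), F (x.1, x.2 + ((m : ℝ), (n : ℝ))) = F x + a :=
    fun m n => exists_int_sub_eq F.continuous (by fun_prop) fun x => by
      rw [hF', hF', planeCover_add_int]
  obtain ⟨a, ha⟩ := key 1 0
  obtain ⟨b, hb⟩ := key 0 1
  simp only [Int.cast_one, Int.cast_zero] at ha hb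
  refine ⟨a, b, ⟨fun z => F (0, z), by fun_prop, fun z => ?_, fun z => ha (0, z),
    fun z => hb (0, z)⟩, ⟨fun z => F (1, z), by fun_prop, fun z => ?_, fun z => ha (1, z),
    fun z => hb (1, z)⟩⟩
  · rw [hF', projIcc_left]
    exact (H.apply_zero _).symm
  · rw [hF', projIcc_right]
    exact (H.apply_one _).symm

/-- The linear automorphism of the torus given by an integer matrix of determinant one. -/
noncomputable def torusAut (m k a b : ℤ) (h : m * a + k * b = 1) : Tor ≃ₜ Tor where
  toFun v := (m • v.1 - b • v.2, k • v.1 + a • v.2)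
  invFun v := (a • v.1 + b • v.2, -k • v.1 + m • v.2)
  left_inv v := by
    have h1 : (a * m + b * k) • v.1 = v.1 := by
      rw [show a * m + b * k = 1 by linarith, one_smul]
    have h2 : (k * b + m * a) • v.2 = v.2 := by
      rw [show k * b + m * a = 1 by linarith, one_smul]
    refine Prod.ext (Eq.trans ?_ h1) (Eq.trans ?_ h2) <;> simp only <;> module
  right_inv v := by
    have h1 : (a * m + b * k) • v.1 = v.1 := by
      rw [show a * m + b * k = 1 by linarith, one_smul]
    have h2 : (k * b + m * a) • v.2 = v.2 := by
      rw [show k * b + m * a = 1 by linarith, one_smul]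
    refine Prod.ext (Eq.trans ?_ h1) (Eq.trans ?_ h2) <;> simp only <;> module
  continuous_toFun := by fun_prop
  continuous_invFun := by fun_prop

theorem HasPeriods.comp_torusAut {p : Tor → Circ} {d a b : ℤ} (hp : HasPeriods p (d * a) (d * b))
    {m k : ℤ} (h : m * a + k * b = 1) :
    HasPeriods (fun v => p (torusAut m k a b h v)) d 0 := by
  obtain ⟨P, hc, hpP, h1, h2⟩ := hp
  have hper : ∀ z (i j : ℤ), P (z + ((i : ℝ), (j : ℝ))) = P z + (i * (d * a) + j * (d * b) : ℤ) := by
    intro z i j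
    have e1 := apply_add_zsmul h1 z i
    have e2 := apply_add_zsmul h2 (z + i • ((1 : ℝ), (0 : ℝ))) j
    rw [e1, add_assoc] at e2
    simpa [add_assoc] using e2
  have hh : (m * a + k * b : ℝ) = 1 := by exact_mod_cast h
  refine ⟨fun z => P (m * z.1 - b * z.2, k * z.1 + a * z.2), by fun_prop, fun z => ?_, fun z => ?_,
    fun z => ?_⟩
  · rw [← hpP]
    refine congrArg _ (Prod.ext ?_ ?_) <;> simp [torusAut, planeCover, ← zsmul_eq_mul]
  · have := hper (m * z.1 - b * z.2, k * z.1 + a * z.2) m k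
    rw [show m * (d * a) + k * (d * b) = d by linear_combination d * h] at this
    rw [← this]
    refine congrArg _ (Prod.ext ?_ ?_) <;> simp <;> ring
  · have := hper (m * z.1 - b * z.2, k * z.1 + a * z.2) (-b) a
    rw [show -b * (d * a) + a * (d * b) = 0 by ring] at this
    rw [← this]
    refine congrArg _ (Prod.ext ?_ ?_) <;> simp <;> ring

theorem HasPeriods.exists_cyl_lift {p : Tor → Circ} {d : ℤ} (hp : HasPeriods p d 0) :
    ∃ P : Cyl → ℝ, Continuous P ∧ (∀ y, p (cylCover y) = P y) ∧
      ∀ y, P (y + (1, 0)) = P y + d := by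
  obtain ⟨P, hc, hpP, h1, h2⟩ := hp
  have hqq := (IsOpenQuotientMap.id (X := ℝ)).prodMap isOpenQuotientMap_coe
  let cov : C(ℝ × ℝ, Cyl) := ⟨Prod.map id (↑), hqq.continuous⟩
  have hq : IsQuotientMap cov := hqq.isQuotientMap
  have hfac : Function.FactorsThrough (⟨P, hc⟩ : C(ℝ × ℝ, ℝ)) cov := by
    rintro ⟨x, t⟩ ⟨x', t'⟩ hyy
    obtain ⟨rfl, h3⟩ := Prod.mk.injEq .. ▸ (show (x, (t : Circ)) = (x', (t' : Circ)) from hyy)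
    obtain ⟨n, rfl⟩ := coe_eq_coe_iff.1 h3
    have := apply_add_zsmul h2 (x, t) n
    simpa using this.symm
  let f : C(Cyl, ℝ) := hq.lift _ hfac
  have hf : ∀ x t : ℝ, f (x, (t : Circ)) = P (x, t) := fun x t =>
    DFunLike.congr_fun (hq.lift_comp _ hfac) (x, t)
  refine ⟨f, f.continuous, ?_, ?_⟩
  · rintro ⟨x, θ⟩
    obtain ⟨t, rfl⟩ := isOpenQuotientMap_coe.surjective θ
    rw [hf]
    exact hpP (x, t)
  · rintro ⟨x, θ⟩
    obtain ⟨t, rfl⟩ := isOpenQuotientMap_coe.surjective θ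
    rw [Prod.mk_add_mk, add_zero, hf, hf, ← h1, Prod.mk_add_mk, add_zero]

theorem HasPeriods.bundleHomotopic_fst {p : C(Tor, Circ)} {d : ℕ} (h : HasPeriods p d 0)
    (hp : IsFiberBundleProj Circ p) : BundleHomotopic ContinuousMap.fst p := by
  obtain ⟨P, hc, hpP, hs⟩ := h.exists_cyl_lift
  simp only [Int.cast_natCast] at hs
  obtain rfl := period_eq_one hp hc hpP hs
  simp only [Nat.cast_one] at hs
  exact (isCylSlide_of_lift hp hc hpP hs).bundleHomotopic_fst hp hpP

theorem BundleHomotopic.comp_homeomorph {f g : C(Tor, Circ)} (h : BundleHomotopic f g)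
    (A : Tor ≃ₜ Tor) : BundleHomotopic (f.comp A) (g.comp A) := by
  obtain ⟨H⟩ := h
  refine ⟨⟨⟨⟨fun x => H (x.1, A x.2), by fun_prop⟩, fun v => H.apply_zero _,
    fun v => H.apply_one _⟩, fun t => ?_⟩⟩
  exact TorusIsotopy.IsFiberBundleProj.comp_homeomorph (H.prop' t) A

theorem exists_natCast_mul_bezout (a b : ℤ) :
    ∃ (d : ℕ) (a' b' m k : ℤ), a = d * a' ∧ b = d * b' ∧ m * a' + k * b' = 1 := by
  rcases Nat.eq_zero_or_pos (Int.gcd a b) with h | h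
  · obtain ⟨rfl, rfl⟩ := Int.gcd_eq_zero_iff.1 h
    exact ⟨0, 1, 0, 1, 0, by simp⟩
  · obtain ⟨a', ha⟩ := Int.gcd_dvd_left a b
    obtain ⟨b', hb⟩ := Int.gcd_dvd_right a b
    refine ⟨Int.gcd a b, a', b', Int.gcdA a b, Int.gcdB a b, ha, hb, ?_⟩
    have h1 := Int.gcd_eq_gcd_ab a b
    have h2 : (Int.gcd a b : ℤ) ≠ 0 := by exact_mod_cast h.ne'
    refine mul_left_cancel₀ h2 ?_
    linear_combination (-Int.gcdA a b) * ha - Int.gcdB a b * hb - h1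

theorem bundleHomotopic_of_homotopic {p q : C(Tor, Circ)} (hp : IsFiberBundleProj Circ p)
    (hq : IsFiberBundleProj Circ q) (h : p.Homotopic q) : BundleHomotopic p q := by
  obtain ⟨a, b, hpp, hqp⟩ := exists_hasPeriods_of_homotopic h
  obtain ⟨d, a, b, m, k, rfl, rfl, hdet⟩ := exists_natCast_mul_bezout a b
  let A := torusAut m k a b hdet
  have key : ∀ f : C(Tor, Circ), IsFiberBundleProj Circ f → HasPeriods f (d * a) (d * b) →
      BundleHomotopic ContinuousMap.fst (f.comp A) := fun f hf hfp =>
    HasPeriods.bundleHomotopic_fst (hfp.comp_torusAut hdet)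
      (TorusIsotopy.IsFiberBundleProj.comp_homeomorph hf A)
  have := BundleHomotopic.comp_homeomorph ((key p hp hpp).symm.trans (key q hq hqp)) A.symm
  simpa [ContinuousMap.comp_assoc] using this

end TorusIsotopy

/-- Two fibrations of the 2-torus `T² = S¹ × S¹` over `S¹` representing the same class in
`H¹(T²; ℤ)` are isotopic.  For maps to the circle, representing the same class in
`H¹(T²; ℤ)` is equivalent to being homotopic; the statement is that two fiber bundle
projections `T² → S¹` which are homotopic are homotopic through fiber bundle
projections (isotopic). -/
theorem torus_fibrations_isotopic
    (p q : C(AddCircle (1 : ℝ) × AddCircle (1 : ℝ), AddCircle (1 : ℝ)))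
    (hp : IsFiberBundleProj (AddCircle (1 : ℝ)) p)
    (hq : IsFiberBundleProj (AddCircle (1 : ℝ)) q)
    (h : p.Homotopic q) :
    ∃ H : ContinuousMap.Homotopy p q,
      ∀ t : unitInterval,
        IsFiberBundleProj (AddCircle (1 : ℝ))
          (ContinuousMap.curry H.toContinuousMap t) := by
  obtain ⟨H⟩ := TorusIsotopy.bundleHomotopic_of_homotopic hp hq h
  exact ⟨H.toHomotopy, H.prop'⟩
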